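/- Let d ≥ 3, n, m ≥ 1, and suppose C(m+d,d) is a multiple of (m+n+1), say C(m+d,d) = h(m+n+1). Then s_1 = s_2 = h(n+1), and consequently the variety σ_s(X^{(n,m)}_{(1,d)}) has the expected dimension min{N, s(n+m+2) − 1} for every s ∈ ℕ, where N = (n+1)·C(m+d,d) − 1. -/

import Mathlib

open MvPolynomial

noncomputable section

/-- The (radical, homogeneous for cones) vanishing ideal of a set `S` of vectors. -/
def vIdeal (K : Type) [Field K] {ι : Type} (S : Set (ι → K)) : Ideal (MvPolynomial ι K) :=
  ⨅ x ∈ S, RingHom.ker (MvPolynomial.eval x)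

/-- Krull dimension of the homogeneous coordinate ring of the (Zariski closure of the)
cone `S`; for a projective variety of dimension `D` this equals `D + 1`. -/
def coneKrullDim (K : Type) [Field K] {ι : Type} (S : Set (ι → K)) : WithBot ℕ∞ :=
  ringKrullDim (MvPolynomial ι K ⧸ vIdeal K S)

/-- The projective variety whose affine cone is the Zariski closure of `S` has
dimension `D` (dimension of a projective variety = Krull dimension of its homogeneous
coordinate ring minus one). -/
def HasProjDim (K : Type) [Field K] {ι : Type} (S : Set (ι → K)) (D : ℕ) : Prop :=
  coneKrullDim K S = ((D : ℕ∞) : WithBot ℕ∞) + 1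

/-- The affine cone over the `s`-th secant variety `σ_s(X)` of the projective variety
with affine cone `C`: (the closure of) the set of sums of `s` elements of `C`.
Since `C` is a cone, sums of `s` elements of `C` are exactly the vectors lying on the
cone over the linear span of `s` points of `X`.  (Taking the Zariski closure does not
change the vanishing ideal, hence does not change the dimension.) -/
def secantCone (K : Type) [Field K] {ι : Type} (C : Set (ι → K)) (s : ℕ) : Set (ι → K) :=
  { y | ∃ x : Fin s → (ι → K), (∀ i, x i ∈ C) ∧ y = ∑ i, x i }

/-- The affine cone over the Segre–Veronese variety `X^{(n,m)}_{(1,d)}`, the image of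
`P^n × P^m` embedded by `O(1,d)` in `P^N`, `N = (n+1)·C(m+d,d) − 1`.  Coordinates of the
ambient `P^N` are indexed by pairs (coordinate of `P^n`, monomial of degree `d` in the
`m+1` coordinates of `P^m`); there are `(n+1)·C(m+d,d)` of them. -/
def svCone (K : Type) [Field K] (n m d : ℕ) :
    Set ((Fin (n + 1) × { μ : Fin (m + 1) → ℕ // ∑ i, μ i = d }) → K) :=
  { v | ∃ (a : Fin (n + 1) → K) (b : Fin (m + 1) → K),
      v = fun p => a p.1 * ∏ i, b i ^ (p.2.1 i) }

namespace SegreVeronese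

open Filter

/-! ### Polynomial functions and generic points -/

section Generic

variable {K : Type*} [Field K] {τ : Type*}

/-- `f` is given by a polynomial in the coordinates. -/
def IsPoly (f : (τ → K) → K) : Prop := ∃ p : MvPolynomial τ K, ∀ b, f b = eval b p

theorem IsPoly.const (c : K) : IsPoly fun _ : τ → K => c := ⟨C c, by simp⟩

theorem IsPoly.coord (i : τ) : IsPoly fun b : τ → K => b i := ⟨X i, by simp⟩

theorem IsPoly.add {f g : (τ → K) → K} (hf : IsPoly f) (hg : IsPoly g) :
    IsPoly fun b => f b + g b := by
  obtain ⟨p, hp⟩ := hf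
  obtain ⟨q, hq⟩ := hg
  exact ⟨p + q, by simp [hp, hq]⟩

theorem IsPoly.mul {f g : (τ → K) → K} (hf : IsPoly f) (hg : IsPoly g) :
    IsPoly fun b => f b * g b := by
  obtain ⟨p, hp⟩ := hf
  obtain ⟨q, hq⟩ := hg
  exact ⟨p * q, by simp [hp, hq]⟩

theorem IsPoly.pow {f : (τ → K) → K} (hf : IsPoly f) (n : ℕ) : IsPoly fun b => f b ^ n := by
  obtain ⟨p, hp⟩ := hf
  exact ⟨p ^ n, by simp [hp]⟩

theorem IsPoly.sum {ι : Type*} {s : Finset ι} {f : ι → (τ → K) → K} (hf : ∀ i, IsPoly (f i)) :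
    IsPoly fun b => ∑ i ∈ s, f i b := by
  choose p hp using hf
  exact ⟨∑ i ∈ s, p i, by simp [hp]⟩

theorem IsPoly.prod {ι : Type*} {s : Finset ι} {f : ι → (τ → K) → K} (hf : ∀ i, IsPoly (f i)) :
    IsPoly fun b => ∏ i ∈ s, f i b := by
  choose p hp using hf
  exact ⟨∏ i ∈ s, p i, by simp [hp]⟩

theorem IsPoly.det {ι : Type*} [Fintype ι] [DecidableEq ι] {M : (τ → K) → Matrix ι ι K}
    (hM : ∀ i j, IsPoly fun b => M b i j) : IsPoly fun b => (M b).det := by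
  simp only [Matrix.det_apply']
  exact IsPoly.sum fun σ => (IsPoly.const _).mul (IsPoly.prod fun i => hM _ _)

theorem IsPoly.comp {τ' : Type*} {f : (τ → K) → K} (hf : IsPoly f) {g : (τ' → K) → τ → K}
    (hg : ∀ i, IsPoly fun b => g b i) : IsPoly fun b => f (g b) := by
  obtain ⟨p, hp⟩ := hf
  choose q hq using hg
  refine ⟨bind₁ q p, fun b => ?_⟩
  have : g b = fun i => eval b (q i) := funext fun i => hq i b
  simp only [hp, this, ← coe_aeval_eq_eval, RingHom.coe_coe, aeval_bind₁]

variable [Infinite K]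

/-- Sets containing the nonvanishing locus of a nonzero polynomial function. -/
def gen (K : Type*) [Field K] [Infinite K] (τ : Type*) : Filter (τ → K) where
  sets := {S | ∃ f : (τ → K) → K, IsPoly f ∧ (∃ b, f b ≠ 0) ∧ ∀ b, f b ≠ 0 → b ∈ S}
  univ_sets := ⟨fun _ => 1, IsPoly.const 1, ⟨0, one_ne_zero⟩, fun _ _ => trivial⟩
  sets_of_superset := by
    rintro S T ⟨f, hf, h0, h⟩ hST
    exact ⟨f, hf, h0, fun b hb => hST (h b hb)⟩
  inter_sets := by
    rintro S T ⟨f, hf, ⟨b, hb⟩, h⟩ ⟨g, hg, ⟨c, hc⟩, h'⟩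
    refine ⟨_, hf.mul hg, ?_, fun b hb => ⟨h b (left_ne_zero_of_mul hb),
      h' b (right_ne_zero_of_mul hb)⟩⟩
    obtain ⟨p, hp⟩ := hf
    obtain ⟨q, hq⟩ := hg
    by_contra! H
    have : p * q = 0 := MvPolynomial.funext fun x => by
      have := H x
      rw [hp, hq] at this
      simpa using this
    rcases mul_eq_zero.1 this with h | h
    · exact hb (by rw [hp, h]; simp)
    · exact hc (by rw [hq, h]; simp)

instance gen_neBot : (gen K τ).NeBot := by
  rw [← forall_mem_nonempty_iff_neBot]
  rintro S ⟨f, -, ⟨b, hb⟩, h⟩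
  exact ⟨b, h b hb⟩

theorem IsPoly.eventually_ne {f : (τ → K) → K} (hf : IsPoly f) (h : ∃ b, f b ≠ 0) :
    ∀ᶠ b in gen K τ, f b ≠ 0 := ⟨f, hf, h, fun _ => id⟩

/-- A polynomial function vanishing at generic points vanishes. -/
theorem IsPoly.eq_zero {f : (τ → K) → K} (hf : IsPoly f) (h : ∀ᶠ b in gen K τ, f b = 0) (b) :
    f b = 0 := by
  by_contra hb
  obtain ⟨c, hc, hc'⟩ := (h.and (hf.eventually_ne ⟨b, hb⟩)).exists
  exact hc' hc

theorem tendsto_gen {τ' : Type*} {g : (τ' → K) → τ → K} (hg : ∀ i, IsPoly fun b => g b i)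
    (hs : Function.Surjective g) : Tendsto g (gen K τ') (gen K τ) := by
  rintro S ⟨f, hf, ⟨b, hb⟩, h⟩
  obtain ⟨c, rfl⟩ := hs b
  exact ⟨_, hf.comp hg, ⟨c, hb⟩, fun c hc => h _ hc⟩

theorem tendsto_gen_comp {τ' : Type*} {e : τ → τ'} (he : Function.Injective e) :
    Tendsto (fun b : τ' → K => b ∘ e) (gen K τ') (gen K τ) :=
  tendsto_gen (fun i => IsPoly.coord (e i)) he.surjective_comp_right

/-- A generic property of pairs holds, at a suitable first component, for generic second
component. -/
theorem exists_eventually_sumElim {α β : Type*} {P : (α ⊕ β → K) → Prop}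
    (h : ∀ᶠ z in gen K (α ⊕ β), P z) : ∃ a, ∀ᶠ b in gen K β, P (Sum.elim a b) := by
  obtain ⟨f, hf, ⟨z, hz⟩, h⟩ := h
  refine ⟨z ∘ Sum.inl, _, hf.comp (g := fun b => Sum.elim (z ∘ Sum.inl) b) ?_, ⟨z ∘ Sum.inr, ?_⟩,
    fun b hb => h _ hb⟩
  · rintro (i | i)
    · exact IsPoly.const _
    · exact IsPoly.coord _
  · rwa [Sum.elim_comp_inl_inr]

end Generic

/-! ### Openness of injectivity and semicontinuity of the rank -/

section Rank

variable {K : Type*} [Field K] [Infinite K] {τ κ V : Type*} [Fintype κ]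
  [AddCommGroup V] [Module K V] [FiniteDimensional K V]

theorem eventually_injective {φ : (τ → K) → V →ₗ[K] (κ → K)}
    (hφ : ∀ v k, IsPoly fun b => φ b v k) {b₀ : τ → K} (h : Function.Injective (φ b₀)) :
    ∀ᶠ b in gen K τ, Function.Injective (φ b) := by
  classical
  obtain ⟨N, hN⟩ := (φ b₀).exists_leftInverse_of_injective (LinearMap.ker_eq_bot.2 h)
  let e := Module.finBasis K V
  have key : ∀ b, LinearMap.det (N ∘ₗ φ b) ≠ 0 → Function.Injective (φ b) := by
    intro b hb
    have h2 := (LinearMap.equivOfDetNeZero _ hb).injective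
    exact Function.Injective.of_comp (f := N) h2
  refine ⟨fun b => LinearMap.det (N ∘ₗ φ b), ?_, ⟨b₀, ?_⟩, key⟩
  · simp only [← LinearMap.det_toMatrix e]
    refine IsPoly.det fun i j => ?_
    have : ∀ b, LinearMap.toMatrix e e (N ∘ₗ φ b) i j =
        ∑ k, φ b (e j) k * e.repr (N (Pi.single k 1)) i := by
      intro b
      rw [LinearMap.toMatrix_apply, LinearMap.comp_apply]
      conv_lhs => rw [pi_eq_sum_univ' (φ b (e j))]
      simp [Finsupp.finsetSum_apply]
    simp only [this]
    exact IsPoly.sum fun k => (hφ _ _).mul (IsPoly.const _)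
  · simp [hN]

theorem eventually_finrank_range_ge {φ : (τ → K) → V →ₗ[K] (κ → K)}
    (hφ : ∀ v k, IsPoly fun b => φ b v k) (b₀ : τ → K) :
    ∀ᶠ b in gen K τ,
      Module.finrank K (LinearMap.range (φ b₀)) ≤ Module.finrank K (LinearMap.range (φ b)) := by
  obtain ⟨U, hU⟩ := (LinearMap.ker (φ b₀)).exists_isCompl
  have hinj : Function.Injective ((φ b₀).domRestrict U) := by
    rw [← LinearMap.ker_eq_bot, LinearMap.ker_domRestrict, ← Submodule.disjoint_iff_comap_eq_bot]
    exact hU.disjoint.symm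
  have hrank : Module.finrank K (LinearMap.range (φ b₀)) = Module.finrank K U := by
    have h1 := (φ b₀).finrank_range_add_finrank_ker
    have h2 := Submodule.finrank_add_eq_of_isCompl hU
    omega
  filter_upwards [eventually_injective (φ := fun b => (φ b).domRestrict U)
    (fun v k => hφ _ _) hinj] with b hb
  rw [hrank, ← LinearMap.finrank_range_of_inj hb]
  apply Submodule.finrank_mono
  rintro _ ⟨x, rfl⟩
  exact ⟨x, rfl⟩

end Rank

end SegreVeronese

namespace SegreVeronese

open Filter

/-! ### Tangent spaces to the Veronese cone, in tensor coordinates -/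

section Tangent

variable {K : Type*} [Field K] {σ : Type*} {d : ℕ}

/-- The rank one tensor with the given factors. -/
def rankOne (K σ : Type*) [Field K] (d : ℕ) :
    MultilinearMap K (fun _ : Fin d => σ → K) ((Fin d → σ) → K) :=
  MultilinearMap.pi fun t =>
    (MultilinearMap.mkPiAlgebra K (Fin d) K).compLinearMap fun l => LinearMap.proj (t l)

theorem rankOne_apply (B : Fin d → σ → K) (t : Fin d → σ) :
    rankOne K σ d B t = ∏ l, B l (t l) := by
  simp [rankOne]

/-- The differential at `b` of the `d`-th power map `b ↦ b ⊗ ⋯ ⊗ b`. -/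
def tan (d : ℕ) (b : σ → K) : (σ → K) →ₗ[K] ((Fin d → σ) → K) :=
  ∑ k, (rankOne K σ d).toLinearMap (fun _ => b) k

theorem tan_apply (b v : σ → K) :
    tan d b v = ∑ k, rankOne K σ d (Function.update (fun _ => b) k v) := by
  simp [tan]

theorem tan_self (b : σ → K) : tan d b b = (d : K) • rankOne K σ d fun _ => b := by
  simp [tan_apply, Function.update_eq_self, Nat.cast_smul_eq_nsmul]

theorem tan_smul_smul (x y : K) (v : σ → K) :
    tan d (x • v) (y • v) = (x ^ (d - 1) * y * d) • rankOne K σ d fun _ => v := by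
  have h : ∀ k : Fin d, rankOne K σ d (Function.update (fun _ => x • v) k (y • v)) =
      (x ^ (d - 1) * y) • rankOne K σ d fun _ => v := by
    intro k
    have : Function.update (fun _ : Fin d => x • v) k (y • v) =
        fun l => (Function.update (fun _ : Fin d => x) k y l) • v := by
      ext l j
      rcases eq_or_ne l k with rfl | hl <;> simp [*]
    rw [this, MultilinearMap.map_smul_univ, Finset.prod_update_of_mem (Finset.mem_univ k)]
    simp [Finset.card_sdiff, mul_comm]
  simp only [tan_apply, h, Finset.sum_const, Finset.card_univ, Fintype.card_fin]
  rw [← Nat.cast_smul_eq_nsmul K, smul_smul, mul_comm]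

theorem isPoly_tan {τ : Type*} {b v : (τ → K) → σ → K} (hb : ∀ i, IsPoly fun z => b z i)
    (hv : ∀ i, IsPoly fun z => v z i) (t : Fin d → σ) : IsPoly fun z => tan d (b z) (v z) t := by
  simp only [tan_apply, Finset.sum_apply, rankOne_apply]
  refine IsPoly.sum fun k => IsPoly.prod fun l => ?_
  rcases eq_or_ne l k with rfl | hl
  · simpa using hv _
  · simpa [hl] using hb _

theorem tan_injective [CharZero K] (hd : d ≠ 0) {b : σ → K} (hb : b ≠ 0) :
    Function.Injective (tan d b) := by
  classical
  rw [← LinearMap.ker_eq_bot, LinearMap.ker_eq_bot']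
  intro v hv
  obtain ⟨j₀, hj⟩ := Function.ne_iff.1 hb
  have hj : b j₀ ≠ 0 := hj
  have e : ∀ t : Fin d → σ, ∑ k : Fin d, v (t k) * ∏ l ∈ Finset.univ \ {k}, b (t l) = 0 := by
    intro t
    have := congrFun hv t
    simp only [tan_apply, Finset.sum_apply, rankOne_apply] at this
    refine Eq.trans ?_ this
    refine Finset.sum_congr rfl fun k _ => ?_
    rw [← Finset.prod_sdiff (Finset.subset_univ {k}), mul_comm]
    congr 1
    · refine Finset.prod_congr rfl fun l hl => ?_
      have : l ≠ k := by simpa using hl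
      simp [this]
    · simp
  have h0 : v j₀ = 0 := by
    have := e fun _ => j₀
    simpa [Finset.card_sdiff, hj, hd] using this
  ext j
  have k₀ : Fin d := ⟨0, Nat.pos_of_ne_zero hd⟩
  have := e (Function.update (fun _ => j₀) k₀ j)
  rw [Finset.sum_eq_single k₀] at this
  · simp only [Function.update_self, mul_eq_zero, Finset.prod_eq_zero_iff] at this
    rcases this with h | ⟨l, hl, h⟩
    · exact h
    · have : l ≠ k₀ := by simpa using hl
      simp [this, hj] at h
  · intro k _ hk
    simp [hk, h0]
  · simp

variable [Fintype σ]

/-- The action of matrices on tensors. -/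
def act (d : ℕ) (g : Matrix σ σ K) : ((Fin d → σ) → K) →ₗ[K] ((Fin d → σ) → K) :=
  Matrix.mulVecLin (Matrix.of fun t t' : Fin d → σ => ∏ l, g (t l) (t' l))

theorem act_rankOne (g : Matrix σ σ K) (B : Fin d → σ → K) :
    act d g (rankOne K σ d B) = rankOne K σ d fun l => g.mulVec (B l) := by
  classical
  ext t
  simp only [act, Matrix.mulVecLin_apply, Matrix.mulVec, dotProduct, Matrix.of_apply, rankOne_apply,
    Finset.prod_univ_sum, ← Finset.prod_mul_distrib, Fintype.piFinset_univ]

theorem act_tan (g : Matrix σ σ K) (b v : σ → K) :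
    act d g (tan d b v) = tan d (g.mulVec b) (g.mulVec v) := by
  simp only [tan_apply, map_sum, act_rankOne]
  refine Finset.sum_congr rfl fun k _ => congrArg _ (funext fun l => ?_)
  rcases eq_or_ne l k with rfl | hl <;> simp [*]

end Tangent

/-! ### Joins of generic tangent spaces -/

section Join

variable {K : Type*} [Field K] {σ : Type*} {d : ℕ}

/-- The span of the tangent spaces at the points `z i`, `i ∈ S`. -/
def join (d : ℕ) (z : ℕ × σ → K) (S : Finset ℕ) : Submodule K ((Fin d → σ) → K) :=
  ⨆ i ∈ S, LinearMap.range (tan d fun j => z (i, j))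

theorem join_insert (z : ℕ × σ → K) (i : ℕ) (S : Finset ℕ) :
    join d z (insert i S) = LinearMap.range (tan d fun j => z (i, j)) ⊔ join d z S :=
  Finset.iSup_insert _ _ _

theorem join_mono (z : ℕ × σ → K) {S T : Finset ℕ} (h : S ⊆ T) : join d z S ≤ join d z T :=
  biSup_mono fun _ hi => h hi

theorem join_congr {z z' : ℕ × σ → K} {S : Finset ℕ} (h : ∀ i ∈ S, ∀ j, z (i, j) = z' (i, j)) :
    join d z S = join d z' S := by
  refine biSup_congr fun i hi => ?_
  simp only [h i hi]

theorem join_image (z : ℕ × σ → K) (e : ℕ → ℕ) (S : Finset ℕ) :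
    join d z (S.image e) = join d (fun p => z (e p.1, p.2)) S :=
  Finset.iSup_finset_image ..

theorem exists_image_eq {A B : Finset ℕ} (h : A.card = B.card) : ∃ e : ℕ → ℕ, A.image e = B := by
  classical
  let f := Finset.equivOfCardEq h
  refine ⟨fun n => if hn : n ∈ A then f ⟨n, hn⟩ else 0, ?_⟩
  ext m
  simp only [Finset.mem_image]
  constructor
  · rintro ⟨n, hn, rfl⟩
    simp [hn]
  · intro hm
    exact ⟨f.symm ⟨m, hm⟩, by simp, by simp⟩

/-- The sum of the tangent maps at the points `z i`, `i ∈ S`. -/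
def joinMap (d : ℕ) {ι : Type*} (z : ι × σ → K) (S : Finset ι) :
    (S → σ → K) →ₗ[K] ((Fin d → σ) → K) :=
  ∑ i : S, (tan d fun j => z (i, j)) ∘ₗ LinearMap.proj i

theorem joinMap_apply {ι : Type*} (z : ι × σ → K) (S : Finset ι) (v : S → σ → K) :
    joinMap d z S v = ∑ i : S, tan d (fun j => z (i, j)) (v i) := by
  simp [joinMap]

theorem range_joinMap (z : ℕ × σ → K) (S : Finset ℕ) :
    LinearMap.range (joinMap d z S) = join d z S := by
  classical
  apply le_antisymm
  · rintro _ ⟨v, rfl⟩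
    rw [joinMap_apply]
    exact Submodule.sum_mem _ fun i _ =>
      Submodule.mem_iSup_of_mem i.1 (Submodule.mem_iSup_of_mem i.2 ⟨_, rfl⟩)
  · refine iSup₂_le fun i hi => ?_
    rintro _ ⟨v, rfl⟩
    refine ⟨Pi.single ⟨i, hi⟩ v, ?_⟩
    rw [joinMap_apply, Finset.sum_eq_single ⟨i, hi⟩]
    · simp
    · intro j _ hj
      simp [hj]
    · simp

variable [Fintype σ]

theorem map_act_join (g : Matrix σ σ K) (z : ℕ × σ → K) (S : Finset ℕ) {u : (Fin d → σ) → K}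
    (hu : u ∈ join d z S) :
    act d g u ∈ join d (fun p => g.mulVec (fun j => z (p.1, j)) p.2) S := by
  rw [← range_joinMap] at hu ⊢
  obtain ⟨v, rfl⟩ := hu
  refine ⟨fun i => g.mulVec (v i), ?_⟩
  simp only [joinMap_apply, map_sum, act_tan]

/-- The dimension of the span of `s` generic tangent spaces. -/
def joinRank (K σ : Type*) [Field K] [Fintype σ] (d s : ℕ) : ℕ :=
  sSup (Set.range fun z : ℕ × σ → K => Module.finrank K (join d z (Finset.range s)))

theorem bddAbove_joinRank (s : ℕ) : BddAbove (Set.range fun z : ℕ × σ → K =>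
    Module.finrank K (join d z (Finset.range s))) := by
  refine ⟨Module.finrank K ((Fin d → σ) → K), ?_⟩
  rintro _ ⟨z, rfl⟩
  exact Submodule.finrank_le _

theorem finrank_join_le (z : ℕ × σ → K) (S : Finset ℕ) :
    Module.finrank K (join d z S) ≤ joinRank K σ d S.card := by
  obtain ⟨e, he⟩ := exists_image_eq (A := Finset.range S.card) (B := S) (by simp)
  conv_lhs => rw [← he, join_image]
  exact le_csSup (bddAbove_joinRank _) ⟨_, rfl⟩

theorem eventually_finrank_join [Infinite K] (S : Finset ℕ) :
    ∀ᶠ z in gen K (ℕ × σ), Module.finrank K (join d z S) = joinRank K σ d S.card := by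
  obtain ⟨z, hz⟩ := Nat.sSup_mem (Set.range_nonempty _) (bddAbove_joinRank (K := K) (σ := σ) (d := d) S.card)
  obtain ⟨e, he⟩ := exists_image_eq (A := S) (B := Finset.range S.card) (by simp)
  change Module.finrank K (join d z _) = joinRank K σ d S.card at hz
  rw [← he, join_image, ← range_joinMap] at hz
  filter_upwards [eventually_finrank_range_ge (φ := fun z => joinMap d z S) (fun v t => by
    simp only [joinMap_apply, Finset.sum_apply]
    exact IsPoly.sum fun i => isPoly_tan (fun j => IsPoly.coord _) (fun j => IsPoly.const (v i j)) t)
    (fun p => z (e p.1, p.2))] with b hb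
  refine le_antisymm (finrank_join_le b S) ?_
  rw [← range_joinMap]
  exact hz.symm.le.trans hb

end Join

end SegreVeronese

namespace SegreVeronese

open Filter Module

section Fill

variable {K : Type*} [Field K] {σ : Type*} [Fintype σ] {d : ℕ}

/-- Apply a matrix to a family of points. -/
def movePoints (g : Matrix σ σ K) (z : ℕ × σ → K) (p : ℕ × σ) : K :=
  g.mulVec (fun j => z (p.1, j)) p.2

theorem movePoints_movePoints (g g' : Matrix σ σ K) (z : ℕ × σ → K) :
    movePoints g (movePoints g' z) = movePoints (g * g') z := by
  ext p
  exact congrFun (Matrix.mulVec_mulVec (fun j => z (p.1, j)) g g') p.2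

theorem movePoints_one [DecidableEq σ] (z : ℕ × σ → K) : movePoints 1 z = z := by
  ext p
  simp [movePoints]

/-- The span of the cone of `d`-th powers. -/
def powSpan (K σ : Type*) [Field K] (d : ℕ) : Submodule K ((Fin d → σ) → K) :=
  Submodule.span K (Set.range fun b : σ → K => rankOne K σ d fun _ => b)

variable [CharZero K]

/-- The tensors lying in the span of the tangent spaces at generic points. -/
def genericJoin (K σ : Type*) [Field K] [CharZero K] (d : ℕ) (S : Finset ℕ) :
    Submodule K ((Fin d → σ) → K) where
  carrier := {u | ∀ᶠ z in gen K (ℕ × σ), u ∈ join d z S}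
  add_mem' {u v} hu hv := by
    rw [Set.mem_ofPred_eq] at *
    filter_upwards [hu, hv] with z h h' using Submodule.add_mem _ h h'
  zero_mem' := by
    rw [Set.mem_ofPred_eq]
    exact Eventually.of_forall fun z => Submodule.zero_mem _
  smul_mem' c u hu := by
    rw [Set.mem_ofPred_eq] at *
    filter_upwards [hu] with z h using Submodule.smul_mem _ c h

theorem act_mem_genericJoin (S : Finset ℕ) {u : (Fin d → σ) → K} (hu : u ∈ genericJoin K σ d S)
    [DecidableEq σ] {g : Matrix σ σ K} (hg : g.det ≠ 0) : act d g u ∈ genericJoin K σ d S := by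
  have hu' := IsUnit.mk0 _ hg
  have hs : Function.Surjective (movePoints g⁻¹) := fun z => ⟨movePoints g z, by
    rw [movePoints_movePoints, Matrix.nonsing_inv_mul _ hu', movePoints_one]⟩
  have ht : Tendsto (movePoints g⁻¹) (gen K _) (gen K _) :=
    tendsto_gen (fun p => IsPoly.sum fun j => (IsPoly.const _).mul (IsPoly.coord _)) hs
  have := ht.eventually (show ∀ᶠ z in gen K (ℕ × σ), u ∈ join d z S from hu)
  refine this.mono fun z hz => ?_
  have := map_act_join g _ S hz
  change _ ∈ join d (movePoints g (movePoints g⁻¹ z)) S at this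
  rwa [movePoints_movePoints, Matrix.mul_nonsing_inv _ hu', movePoints_one] at this

/-- If the generic join contains a nonzero tangent vector, then it contains all powers. -/
theorem powSpan_le_genericJoin (hd : d ≠ 0) (S : Finset ℕ) {x w : σ → K} (hx : x ≠ 0) (hw : w ≠ 0)
    (hu : tan d x w ∈ genericJoin K σ d S) : powSpan K σ d ≤ genericJoin K σ d S := by
  classical
  refine Submodule.span_le.2 ?_
  rintro _ ⟨v, rfl⟩
  have key : ∀ g : Matrix σ σ K, tan d (g.mulVec x) (g.mulVec w) ∈ genericJoin K σ d S := by
    intro g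
    rw [← Subspace.forall_mem_dualAnnihilator_apply_eq_zero_iff]
    intro φ hφ
    have hp : IsPoly fun z : σ × σ → K => φ (tan d ((Matrix.of fun i j => z (i, j)).mulVec x)
        ((Matrix.of fun i j => z (i, j)).mulVec w)) := by
      have : ∀ u : (Fin d → σ) → K, φ u = ∑ t, u t * φ (Pi.single t 1) := by
        intro u
        conv_lhs => rw [pi_eq_sum_univ' u]
        simp only [map_sum, map_smul, smul_eq_mul]
      simp_rw [this (tan d _ _)]
      have hm : ∀ (y : σ → K) (i : σ), IsPoly fun z : σ × σ → K =>
          (Matrix.of fun i j => z (i, j)).mulVec y i := fun y i =>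
        IsPoly.sum fun j => (IsPoly.coord _).mul (IsPoly.const _)
      exact IsPoly.sum fun t => (isPoly_tan (hm x) (hm w) t).mul (IsPoly.const _)
    refine hp.eq_zero ?_ fun p => g p.1 p.2
    have hdet : IsPoly fun z : σ × σ → K => (Matrix.of fun i j => z (i, j)).det :=
      IsPoly.det fun i j => IsPoly.coord _
    filter_upwards [hdet.eventually_ne ⟨fun p => (1 : Matrix σ σ K) p.1 p.2, by
      change (1 : Matrix σ σ K).det ≠ 0
      simp⟩] with z hz
    rw [← act_tan]
    exact (Submodule.mem_dualAnnihilator _).1 hφ _ (act_mem_genericJoin S hu hz)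
  obtain ⟨i, hi⟩ := Function.ne_iff.1 hx
  obtain ⟨j, hj⟩ := Function.ne_iff.1 hw
  have hl : ∀ y : σ → K, IsPoly fun z : σ → K => ∑ i, z i * y i := fun y =>
    IsPoly.sum fun j => (IsPoly.coord _).mul (IsPoly.const _)
  obtain ⟨l, h1, h2⟩ := (((hl x).eventually_ne ⟨Pi.single i 1, by simpa [Pi.single_apply] using hi⟩).and
    ((hl w).eventually_ne ⟨Pi.single j 1, by simpa [Pi.single_apply] using hj⟩)).exists
  have := key (Matrix.vecMulVec v l)
  have hv : ∀ y, (Matrix.vecMulVec v l).mulVec y = (∑ i, l i * y i) • v := by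
    intro y
    rw [Matrix.vecMulVec_mulVec]
    ext i
    simp [dotProduct, mul_comm]
  rw [hv, hv, tan_smul_smul] at this
  refine (Submodule.smul_mem_iff _ ?_).1 this
  have : (d : K) ≠ 0 := by exact_mod_cast hd
  positivity

end Fill
end SegreVeronese

namespace SegreVeronese

open Filter Module

section Growth

variable {K : Type*} [Field K] [CharZero K] {σ : Type*} [Fintype σ] {d : ℕ}

theorem eventually_finrank_joins (n : ℕ) : ∀ᶠ z in gen K (ℕ × σ), ∀ S ⊆ Finset.range n,
    finrank K (join d z S) = joinRank K σ d S.card := by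
  have := (Filter.eventually_all_finset (Finset.range n).powerset).2
    fun S _ => eventually_finrank_join (K := K) (σ := σ) (d := d) S
  simpa only [Finset.mem_powerset] using this

theorem eventually_point_ne_zero {K σ : Type*} [Field K] [Infinite K] [Nonempty σ] (i : ℕ) :
    ∀ᶠ z in gen K (ℕ × σ), (fun j => z (i, j)) ≠ 0 := by
  obtain ⟨j⟩ := ‹Nonempty σ›
  filter_upwards [(IsPoly.coord (K := K) (i, j)).eventually_ne ⟨1, one_ne_zero⟩] with z hz h
  exact hz (congrFun h j)

theorem finrank_range_tan (hd : d ≠ 0) {b : σ → K} (hb : b ≠ 0) :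
    finrank K (LinearMap.range (tan d b)) = Fintype.card σ := by
  rw [LinearMap.finrank_range_of_inj (tan_injective hd hb), finrank_fintype_fun_eq_card]

theorem finrank_tan_inf_join (hd : d ≠ 0) {n : ℕ} {z : ℕ × σ → K}
    (hz : ∀ S ⊆ Finset.range n, finrank K (join d z S) = joinRank K σ d S.card)
    (h0 : (fun j => z (0, j)) ≠ 0) {S : Finset ℕ} (hS : S ⊆ Finset.range n) (hn : 0 < n)
    (h0S : 0 ∉ S) :
    finrank K (LinearMap.range (tan d fun j => z (0, j)) ⊓ join d z S : Submodule K _) +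
      joinRank K σ d (S.card + 1) = Fintype.card σ + joinRank K σ d S.card := by
  have h := Submodule.finrank_sup_add_finrank_inf_eq
    (LinearMap.range (tan d fun j => z (0, j))) (join d z S)
  rw [← join_insert, hz _ (Finset.insert_subset (Finset.mem_range.2 hn) hS), hz S hS,
    finrank_range_tan hd h0, Finset.card_insert_of_notMem h0S] at h
  omega

theorem joinRank_mono : Monotone (joinRank K σ d) := by
  intro s t hst
  obtain ⟨z, hz⟩ := (eventually_finrank_joins (K := K) (σ := σ) (d := d) t).exists
  have h1 := hz (Finset.range s) (by simpa using hst)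
  have h2 := hz (Finset.range t) subset_rfl
  rw [Finset.card_range] at h1 h2
  rw [← h1, ← h2]
  exact Submodule.finrank_mono (join_mono z (by simpa using hst))

variable [Nonempty σ]

theorem joinRank_add_joinRank_le (hd : d ≠ 0) (s : ℕ) :
    joinRank K σ d (s + 2) + joinRank K σ d s ≤ 2 * joinRank K σ d (s + 1) := by
  obtain ⟨z, hz, h0⟩ := ((eventually_finrank_joins (K := K) (σ := σ) (d := d) (s + 2)).and
    (eventually_point_ne_zero 0)).exists
  have h1 := finrank_tan_inf_join hd hz h0 (S := Finset.Ioc 0 s)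
    (fun x hx => by simp at hx ⊢; omega) (by simp) (by simp)
  have h2 := finrank_tan_inf_join hd hz h0 (S := Finset.Ioc 0 (s + 1))
    (fun x hx => by simp at hx ⊢; omega) (by simp) (by simp)
  have h3 := Submodule.finrank_mono (inf_le_inf_left (LinearMap.range (tan d fun j => z (0, j)))
    (join_mono (d := d) z (show Finset.Ioc 0 s ⊆ Finset.Ioc 0 (s + 1) from
      Finset.Ioc_subset_Ioc_right (by simp))))
  simp only [Nat.card_Ioc, Nat.sub_zero, add_assoc, Nat.reduceAdd] at h1 h2
  omega

/-- Overlapping generic tangent spaces whose growth stalls span everything. -/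
theorem finrank_powSpan_le_of_stall (hd : d ≠ 0) {s : ℕ}
    (h1 : joinRank K σ d (s + 1) < joinRank K σ d s + Fintype.card σ)
    (h2 : 2 * joinRank K σ d (s + 1) ≤ joinRank K σ d (s + 2) + joinRank K σ d s) :
    finrank K (powSpan K σ d) ≤ joinRank K σ d s := by
  have hz : ∀ᶠ z in gen K (ℕ × σ), (fun j => z (0, j)) ≠ 0 ∧
      LinearMap.range (tan d fun j => z (0, j)) ⊓ join d z (Finset.Ioc 0 s) ≠ ⊥ ∧
      LinearMap.range (tan d fun j => z (0, j)) ⊓ join d z (Finset.Ioc 0 s) ≤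
        join d z (Finset.Ioc s (s + s)) := by
    filter_upwards [eventually_finrank_joins (K := K) (σ := σ) (d := d) (2 * s + 2),
      eventually_point_ne_zero 0] with z hz h0
    have hr := fun S hS h => finrank_tan_inf_join hd hz h0 (S := S) hS (by omega) h
    have hI : ∀ k j, k + j ≤ 2 * s + 1 → Finset.Ioc k (k + j) ⊆ Finset.range (2 * s + 2) :=
      fun k j h x hx => by simp at hx ⊢; omega
    refine ⟨h0, fun hb => ?_, ?_⟩
    · have := hr (Finset.Ioc 0 s) (by simpa using hI 0 s (by omega)) (by simp)
      rw [hb, finrank_bot] at this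
      simp only [Nat.card_Ioc, Nat.sub_zero] at this
      omega
    · have step : ∀ k < s,
          LinearMap.range (tan d fun j => z (0, j)) ⊓ join d z (Finset.Ioc k (k + s)) =
          LinearMap.range (tan d fun j => z (0, j)) ⊓
            join d z (Finset.Ioc (k + 1) (k + 1 + s)) := by
        intro k hk
        have a1 := hr _ (hI k s (by omega)) (by simp)
        have a2 := hr _ (hI k (s + 1) (by omega)) (by simp)
        have a3 := hr _ (hI (k + 1) s (by omega)) (by simp)
        simp only [Nat.card_Ioc, Nat.add_sub_cancel_left, add_assoc s, Nat.reduceAdd] at a1 a2 a3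
        have b1 := join_mono (d := d) z (show Finset.Ioc k (k + s) ⊆ Finset.Ioc k (k + (s + 1)) from
          Finset.Ioc_subset_Ioc_right (by omega))
        have b2 := join_mono (d := d) z
          (show Finset.Ioc (k + 1) (k + 1 + s) ⊆ Finset.Ioc k (k + (s + 1)) from
            Finset.Ioc_subset_Ioc (by omega) (by omega))
        rw [Submodule.eq_of_le_of_finrank_le (inf_le_inf_left _ b1) (by omega),
          Submodule.eq_of_le_of_finrank_le (inf_le_inf_left _ b2) (by omega)]
      have all : ∀ k ≤ s,
          LinearMap.range (tan d fun j => z (0, j)) ⊓ join d z (Finset.Ioc 0 s) =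
          LinearMap.range (tan d fun j => z (0, j)) ⊓ join d z (Finset.Ioc k (k + s)) := by
        intro k
        induction k with
        | zero => simp
        | succ k ih => exact fun hk => (ih (by omega)).trans (step k (by omega))
      rw [all s le_rfl]
      exact inf_le_right
  let e : ℕ × σ → (ℕ × σ) ⊕ (ℕ × σ) := fun p => if p.1 ≤ s then Sum.inl p else Sum.inr p
  have he : Function.Injective e := by
    intro p q h
    simp only [e] at h
    split_ifs at h <;> simpa using h
  obtain ⟨a, ha⟩ := exists_eventually_sumElim ((tendsto_gen_comp he).eventually hz)
  have e0 : ∀ b j, (Sum.elim a b ∘ e) (0, j) = a (0, j) := fun b j => by simp [e]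
  have eS : ∀ b, join d (Sum.elim a b ∘ e) (Finset.Ioc 0 s) = join d a (Finset.Ioc 0 s) :=
    fun b => join_congr fun i hi j => by simp [e, (Finset.mem_Ioc.1 hi).2]
  have eT : ∀ b, join d (Sum.elim a b ∘ e) (Finset.Ioc s (s + s)) = join d b (Finset.Ioc s (s + s)) :=
    fun b => join_congr fun i hi j => by
      simp [e, (Finset.mem_Ioc.1 hi).1.not_ge]
  simp only [e0, eS, eT] at ha
  obtain ⟨-, hx, hne, -⟩ := ha.exists
  obtain ⟨u, ⟨⟨w, rfl⟩, hu⟩, hu0⟩ := Submodule.exists_mem_ne_zero_of_ne_bot hne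
  have hw : w ≠ 0 := by
    rintro rfl
    simp at hu0
  have hN := powSpan_le_genericJoin hd (Finset.Ioc s (s + s)) hx hw
    (ha.mono fun b hb => hb.2.2 ⟨⟨w, rfl⟩, hu⟩)
  obtain ⟨F, hF⟩ := IsNoetherian.noetherian (genericJoin K σ d (Finset.Ioc s (s + s)))
  have hall : ∀ᶠ z in gen K (ℕ × σ), ∀ u ∈ F, u ∈ join d z (Finset.Ioc s (s + s)) :=
    (Filter.eventually_all_finset F).2 fun u hu => hF.le (Submodule.subset_span hu)
  obtain ⟨z, hz⟩ := hall.exists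
  have hle : powSpan K σ d ≤ join d z (Finset.Ioc s (s + s)) :=
    hN.trans (hF.symm.le.trans (Submodule.span_le.2 hz))
  simpa using (Submodule.finrank_mono hle).trans (finrank_join_le z _)

/-- If adding one tangent space adds at most `k` dimensions, the remaining codimension is at
most `k + (k - 1) + ⋯ + 1`. -/
theorem finrank_powSpan_le_add (hd : d ≠ 0) {k : ℕ} (hk : k < Fintype.card σ) {s : ℕ}
    (h : joinRank K σ d (s + 1) ≤ joinRank K σ d s + k) :
    finrank K (powSpan K σ d) ≤ joinRank K σ d s + k * (k + 1) / 2 := by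
  induction k generalizing s with
  | zero =>
    have h1 := joinRank_mono (K := K) (σ := σ) (d := d) (show s + 1 ≤ s + 2 by simp)
    have h2 := joinRank_mono (K := K) (σ := σ) (d := d) (show s ≤ s + 1 by simp)
    have := finrank_powSpan_le_of_stall (K := K) (σ := σ) hd (s := s) (by omega) (by omega)
    simpa using this
  | succ k ih =>
    have e : (k + 1) * (k + 1 + 1) / 2 = k * (k + 1) / 2 + (k + 1) := by
      rw [show (k + 1) * (k + 1 + 1) = k * (k + 1) + 2 * (k + 1) by ring,
        Nat.add_mul_div_left _ _ two_pos]
    have h2 := joinRank_add_joinRank_le (K := K) (σ := σ) hd s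
    by_cases hs : joinRank K σ d (s + 1) ≤ joinRank K σ d s + k
    · have := ih (by omega) hs
      omega
    by_cases h3 : 2 * joinRank K σ d (s + 1) ≤ joinRank K σ d (s + 2) + joinRank K σ d s
    · have := finrank_powSpan_le_of_stall (K := K) (σ := σ) hd (s := s) (by omega) h3
      omega
    · have := ih (by omega) (s := s + 1) (by change joinRank K σ d (s + 2) ≤ _; omega)
      omega

/-- The generic join has the expected dimension as long as there is enough room. -/
theorem joinRank_eq (hd : d ≠ 0) {h : ℕ}
    (hh : h * Fintype.card σ + Fintype.card σ * (Fintype.card σ - 1) / 2 <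
      finrank K (powSpan K σ d) + Fintype.card σ) :
    joinRank K σ d h = h * Fintype.card σ := by
  have hr := Fintype.card_pos (α := σ)
  induction h with
  | zero =>
    obtain ⟨z, hz⟩ := (eventually_finrank_join (K := K) (σ := σ) (d := d) ∅).exists
    have hbot : join d z ∅ = ⊥ := by simp [join]
    rw [hbot, finrank_bot, Finset.card_empty] at hz
    rw [← hz, zero_mul]
  | succ s ih =>
    have e := Nat.add_one_mul s (Fintype.card σ)
    have hs := ih (by omega)
    have hle : joinRank K σ d (s + 1) ≤ joinRank K σ d s + Fintype.card σ := by
      obtain ⟨z, hz⟩ := (eventually_finrank_joins (K := K) (σ := σ) (d := d) (s + 1)).exists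
      have h1 := hz (Finset.range s) (by simp)
      have h2 := hz (Finset.range (s + 1)) subset_rfl
      rw [Finset.card_range] at h1 h2
      rw [← h1, ← h2, Finset.range_add_one, join_insert, add_comm]
      refine (Submodule.finrank_add_le_finrank_add_finrank _ _).trans (add_le_add_left ?_ _)
      refine (LinearMap.finrank_range_le _).trans ?_
      rw [finrank_fintype_fun_eq_card]
    by_contra hne
    have := finrank_powSpan_le_add (K := K) (σ := σ) hd (k := Fintype.card σ - 1) (s := s)
      (by omega) (by omega)
    rw [Nat.sub_add_cancel hr, mul_comm (_ - 1)] at this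
    omega

end Growth
end SegreVeronese

namespace SegreVeronese

open Filter Module

/-! ### Monomial coordinates -/

section Mon

/-- Exponents of monomials of degree `d`. -/
abbrev Mon (σ : Type*) [Fintype σ] (d : ℕ) := {μ : σ → ℕ // ∑ i, μ i = d}

variable {K : Type} [Field K] {σ : Type*} [Fintype σ] {d : ℕ}

instance : Fintype (Mon σ d) := by
  classical exact Fintype.ofEquiv _ (Sym.equivNatSumOfFintype σ d)

theorem card_mon : Fintype.card (Mon σ d) = (Fintype.card σ + d - 1).choose d := by
  classical
  rw [← Fintype.card_congr (Sym.equivNatSumOfFintype σ d), Sym.card_sym_eq_choose]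

theorem exists_indices (μ : Mon σ d) : ∃ t : Fin d → σ, ∀ (R : Type) [CommRing R] (f : σ → R),
    ∏ k, f (t k) = ∏ i, f i ^ μ.1 i := by
  classical
  let s : Multiset σ := ∑ i, μ.1 i • {i}
  have hs : Multiset.card s = d := by simp [s, μ.2]
  obtain ⟨l, hl⟩ : ∃ l : List σ, (l : Multiset σ) = s := ⟨s.toList, s.coe_toList⟩
  have hd : l.length = d := by rw [← hs, ← hl, Multiset.coe_card]
  subst hd
  refine ⟨l.get, fun R _ f => ?_⟩
  have h1 : (s.map f).prod = ∏ i, f i ^ μ.1 i := by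
    simp only [s, ← Multiset.coe_mapAddMonoidHom, map_sum, Multiset.prod_sum]
    simp [Multiset.map_nsmul, Multiset.prod_nsmul]
  rw [← h1, ← hl, Multiset.map_coe, Multiset.prod_coe, ← List.prod_ofFn]
  congr 1
  change List.ofFn (f ∘ l.get) = _
  rw [← List.map_ofFn, List.ofFn_get]

theorem prod_indices_eq (t : Fin d → σ) : ∃ μ : Mon σ d, ∀ (R : Type) [CommRing R] (f : σ → R),
    ∏ k, f (t k) = ∏ i, f i ^ μ.1 i := by
  classical
  refine ⟨⟨fun i => (Finset.univ.filter fun k => t k = i).card, ?_⟩, fun R _ f => ?_⟩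
  · simpa using (Finset.card_eq_sum_card_fiberwise (f := t) (s := Finset.univ) (t := Finset.univ)
      (by simp)).symm
  · rw [← Finset.prod_fiberwise_of_maps_to (g := t) (t := Finset.univ) (by simp)]
    refine Finset.prod_congr rfl fun i _ => ?_
    rw [Finset.prod_congr rfl fun k hk => by rw [(Finset.mem_filter.1 hk).2], Finset.prod_const]

/-- A list of `d` indices representing the monomial `μ`. -/
def indices (μ : Mon σ d) : Fin d → σ := (exists_indices μ).choose

theorem prod_indices (μ : Mon σ d) {R : Type} [CommRing R] (f : σ → R) :
    ∏ k, f (indices μ k) = ∏ i, f i ^ μ.1 i := (exists_indices μ).choose_spec R f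

theorem tan_apply_eq_derivative {σ : Type*} (b v : σ → K) (t : Fin d → σ) : tan d b v t =
    (Polynomial.derivative
      (∏ k, (Polynomial.C (b (t k)) + Polynomial.C (v (t k)) * Polynomial.X))).eval 0 := by
  classical
  rw [Polynomial.derivative_prod_finset, Polynomial.eval_finsetSum]
  simp only [tan_apply, Finset.sum_apply, rankOne_apply]
  refine Finset.sum_congr rfl fun k _ => ?_
  rw [← Finset.prod_erase_mul _ _ (Finset.mem_univ k), Polynomial.eval_mul, Polynomial.eval_prod]
  congr 1
  · refine Finset.prod_congr rfl fun l hl => ?_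
    simp [Finset.ne_of_mem_erase hl]
  · simp

theorem exists_tan_apply_eq (t : Fin d → σ) :
    ∃ μ : Mon σ d, ∀ b v : σ → K, tan d b v t = tan d b v (indices μ) := by
  obtain ⟨μ, hμ⟩ := prod_indices_eq t
  refine ⟨μ, fun b v => ?_⟩
  rw [tan_apply_eq_derivative, tan_apply_eq_derivative,
    hμ _ fun i => Polynomial.C (b i) + Polynomial.C (v i) * Polynomial.X,
    prod_indices μ fun i => Polynomial.C (b i) + Polynomial.C (v i) * Polynomial.X]

/-- The vector of monomials of degree `d` at `b`. -/
def monomials (d : ℕ) (b : σ → K) : Mon σ d → K := fun μ => ∏ i, b i ^ μ.1 i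

theorem rankOne_indices (b : σ → K) (μ : Mon σ d) :
    rankOne K σ d (fun _ => b) (indices μ) = monomials d b μ := by
  rw [rankOne_apply, prod_indices μ b, monomials]

theorem span_monomials [Infinite K] :
    Submodule.span K (Set.range (monomials (K := K) (σ := σ) d)) = ⊤ := by
  classical
  by_contra hne
  obtain ⟨φ, hφ0, hφ⟩ := Submodule.exists_dual_map_eq_bot_of_lt_top (lt_top_iff_ne_top.2 hne)
    inferInstance
  rw [← le_bot_iff, Submodule.map_le_iff_le_comap, Submodule.comap_bot] at hφ
  apply hφ0
  let p : MvPolynomial σ K := ∑ μ : Mon σ d,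
    monomial (Finsupp.equivFunOnFinite.symm μ.1) (φ (Pi.single μ 1))
  have hp : p = 0 := by
    refine MvPolynomial.funext fun b => ?_
    have := LinearMap.mem_ker.1 (hφ (Submodule.subset_span ⟨b, rfl⟩))
    rw [pi_eq_sum_univ' (monomials d b)] at this
    simp only [map_sum, map_smul, smul_eq_mul] at this
    rw [map_zero, ← this]
    simp only [p, map_sum, eval_monomial, monomials]
    refine Finset.sum_congr rfl fun μ _ => ?_
    rw [mul_comm, Finsupp.prod_fintype _ _ (by simp)]
    rfl
  refine LinearMap.pi_ext' fun μ => LinearMap.ext_ring ?_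
  have := congrArg (coeff (Finsupp.equivFunOnFinite.symm μ.1)) hp
  simp only [p, coeff_sum, coeff_monomial, coeff_zero] at this
  rw [Finset.sum_eq_single μ] at this
  · simpa using this
  · intro ν _ hν
    rw [if_neg]
    exact fun h => hν (Subtype.ext (Finsupp.equivFunOnFinite.symm.injective h))
  · simp

theorem card_mon_le_finrank_powSpan [Infinite K] :
    Fintype.card (Mon σ d) ≤ finrank K (powSpan K σ d) := by
  let ρ : ((Fin d → σ) → K) →ₗ[K] (Mon σ d → K) := LinearMap.funLeft K K indices
  have h : (powSpan K σ d).map ρ = ⊤ := by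
    rw [powSpan, Submodule.map_span, ← Set.range_comp, ← span_monomials]
    congr 2
    ext b μ
    exact rankOne_indices b μ
  rw [← finrank_fintype_fun_eq_card (R := K), ← finrank_top, ← h]
  exact Submodule.finrank_map_le _ _

end Mon
end SegreVeronese

namespace SegreVeronese

open Filter Module

/-- There are points indexed by `ι` whose tangent spaces to the `d`-th Veronese cone are
linearly independent. -/
def Independent (K σ : Type*) [Field K] (d : ℕ) (ι : Type*) [Fintype ι] : Prop :=
  ∃ z : ι → σ → K, ∀ v : ι → σ → K, ∑ i, tan d (z i) (v i) = 0 → v = 0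

theorem Independent.of_injective {K σ : Type*} [Field K] {d : ℕ} {ι ι' : Type*} [Fintype ι]
    [Fintype ι'] (h : Independent K σ d ι) {f : ι' → ι} (hf : Function.Injective f) :
    Independent K σ d ι' := by
  classical
  obtain ⟨z, hz⟩ := h
  refine ⟨z ∘ f, fun v hv => ?_⟩
  have := hz (Function.extend f v 0) ?_
  · rw [← hf.extend_apply v 0 |> funext |> fun h => (h : Function.extend f v 0 ∘ f = v), this]
    rfl
  · rw [← hv, ← Finset.sum_subset (Finset.subset_univ (Finset.univ.image f)), Finset.sum_image]
    · simp [hf.extend_apply]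
    · exact fun a _ b _ h => hf h
    · intro i _ hi
      rw [Function.extend_apply' _ _ _ (by simpa using hi)]
      simp

theorem Independent.of_card_le {K σ : Type*} [Field K] {d : ℕ} {ι ι' : Type*} [Fintype ι]
    [Fintype ι'] (h : Independent K σ d ι) (hc : Fintype.card ι' ≤ Fintype.card ι) :
    Independent K σ d ι' := by
  obtain ⟨f⟩ := Function.Embedding.nonempty_of_card_le hc
  exact h.of_injective f.injective

/-- Tangent spaces at general points are independent when they leave enough room. -/
theorem independent_of_card_lt {K : Type} [Field K] [CharZero K] {m d h : ℕ} (hd : d ≠ 0)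
    (hh : h * (m + 1) + (m + 1) * m / 2 < (m + d).choose d + (m + 1)) :
    Independent K (Fin (m + 1)) d (Fin h) := by
  have hc := card_mon_le_finrank_powSpan (K := K) (σ := Fin (m + 1)) (d := d)
  rw [card_mon, Fintype.card_fin, show m + 1 + d - 1 = m + d by omega] at hc
  have hr := joinRank_eq (K := K) (σ := Fin (m + 1)) (d := d) (h := h) hd (by
    rw [Fintype.card_fin, Nat.add_sub_cancel]
    omega)
  obtain ⟨z, hz⟩ := (eventually_finrank_join (K := K) (σ := Fin (m + 1)) (d := d)
    (Finset.range h)).exists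
  rw [Finset.card_range, hr, ← range_joinMap] at hz
  have hinj : Function.Injective (joinMap d z (Finset.range h)) := by
    have h1 := (joinMap d z (Finset.range h)).finrank_range_add_finrank_ker
    rw [hz, finrank_pi_fintype] at h1
    simp only [finrank_fintype_fun_eq_card, Fintype.card_fin, Finset.sum_const, Finset.card_univ,
      Fintype.card_coe, Finset.card_range, smul_eq_mul, Nat.add_eq_left] at h1
    exact LinearMap.ker_eq_bot.1 (Submodule.finrank_eq_zero.1 h1)
  refine Independent.of_card_le (ι := Finset.range h) ⟨fun i j => z (i, j), fun v hv => ?_⟩ (by simp)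
  rw [← joinMap_apply] at hv
  exact hinj (hv.trans (map_zero _).symm)

theorem independent_of_four_le {K : Type} [Field K] [CharZero K] {m d h : ℕ} (hd : 4 ≤ d)
    (hh : h * (m + 2) ≤ (m + d).choose d) : Independent K (Fin (m + 1)) d (Fin h) := by
  refine independent_of_card_lt (by omega) ?_
  have h1 : (m + 4).choose 4 ≤ (m + d).choose d := by
    rw [← Nat.choose_symm_add, ← Nat.choose_symm_add (a := m) (b := d)]
    exact Nat.choose_le_choose _ (by omega)
  have h2 : (m + 4).choose 4 * 24 = (m + 1) * (m + 2) * (m + 3) * (m + 4) := by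
    have := Nat.ascFactorial_eq_factorial_mul_choose m 4
    simp only [Nat.ascFactorial, Nat.factorial] at this
    linarith
  have h3 : (m + 1) * m / 2 * 2 = (m + 1) * m :=
    Nat.div_mul_cancel (by
      have := Nat.even_mul_succ_self m
      rw [mul_comm]
      exact this.two_dvd)
  generalize (m + d).choose d = C at *
  generalize (m + 1) * m / 2 = T at *
  generalize (m + 4).choose 4 = B at *
  zify at *
  by_contra! hcon
  have h4 : (h : ℤ) * (m + 2) * (m + 1) ≤ C * (m + 1) := by gcongr
  have h5 : ((C : ℤ) + (m + 1)) * (m + 2) ≤ (h * (m + 1) + T) * (m + 2) := by gcongr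
  have h6 : (B : ℤ) + (m + 1) * (m + 2) ≤ T * (m + 2) := by linarith
  have h7 : ((m : ℤ) + 1) * (m + 2) * ((m + 3) * (m + 4) + 24) ≤
      (m + 1) * (m + 2) * (12 * m) := by
    nlinarith
  have h8 := le_of_mul_le_mul_left h7 (by positivity)
  nlinarith [sq_nonneg ((m : ℤ) - 2)]

theorem independent_binary_cubics {K : Type} [Field K] [CharZero K] {h : ℕ}
    (hh : h * 3 ≤ 4) : Independent K (Fin 2) 3 (Fin h) := by
  refine independent_of_card_lt (m := 1) (by omega) ?_
  simp [Nat.choose]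
  omega

end SegreVeronese

namespace SegreVeronese

open Filter Module

/-! ### Degeneration of systems of tangent vectors -/

section Degenerate

variable {K : Type} [Field K] {σ σ' ι ι' : Type}

open Classical in
/-- The points obtained from `z` by erasing the coordinates outside `S`. -/
def erase (S : ι → σ → Prop) (z : ι × σ → K) (i : ι) (j : σ) : K := if S i j then z (i, j) else 0

/-- For suitable points with supports in `S`, tangent vectors to the cubic Veronese cone in
directions supported in `T` are linearly independent in their coordinates in `E`. -/
def IndepOn (K : Type) [Field K] [Fintype ι] (S T : ι → σ → Prop) (E : (Fin 3 → σ) → Prop) (z : ι × σ → K) :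
    Prop :=
  ∀ v : ι → σ → K, (∀ i j, ¬ T i j → v i j = 0) →
    (∀ t, E t → ∑ i, tan 3 (erase S z i) (v i) t = 0) → v = 0

theorem tan_three {σ : Type*} (b v : σ → K) (t : Fin 3 → σ) : tan 3 b v t =
    v (t 0) * b (t 1) * b (t 2) + b (t 0) * v (t 1) * b (t 2) + b (t 0) * b (t 1) * v (t 2) := by
  simp [tan_apply, rankOne_apply, Fin.sum_univ_three, Fin.prod_univ_three, Function.update]

theorem isPoly_erase (S : ι → σ → Prop) (i : ι) (j : σ) :
    IsPoly fun z : ι × σ → K => erase S z i j := by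
  unfold erase
  split_ifs
  · exact IsPoly.coord _
  · exact IsPoly.const 0

theorem erase_erase {S S' : ι → σ → Prop} (h : ∀ i j, S' i j → S i j) (z : ι × σ → K) :
    erase S (fun k => erase S' z k.1 k.2) = erase S' z := by
  ext i j
  have := h i j
  simp only [erase]
  split_ifs <;> tauto

theorem exists_indepOn_mono [Fintype ι] {S S' T : ι → σ → Prop} {E : (Fin 3 → σ) → Prop}
    (h : ∀ i j, S' i j → S i j) (h' : ∃ z, IndepOn K S' T E z) : ∃ z, IndepOn K S T E z := by
  obtain ⟨z, hz⟩ := h'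
  refine ⟨fun k => erase S' z k.1 k.2, fun v hT hE => hz v hT ?_⟩
  rwa [erase_erase h] at hE

theorem eventually_indepOn [Infinite K] [Fintype σ] [Fintype ι] {S T : ι → σ → Prop} {E : (Fin 3 → σ) → Prop}
    (h : ∃ z, IndepOn K S T E z) : ∀ᶠ z in gen K (ι × σ), IndepOn K S T E z := by
  classical
  obtain ⟨z₀, h⟩ := h
  let V : Submodule K (ι → σ → K) :=
    { carrier := {v | ∀ i j, ¬ T i j → v i j = 0}
      add_mem' := fun hu hv i j hT => by simp [hu i j hT, hv i j hT]
      zero_mem' := fun _ _ _ => rfl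
      smul_mem' := fun c u hu i j hT => by simp [hu i j hT] }
  let φ (z : ι × σ → K) : V →ₗ[K] ({t // E t} → K) :=
    LinearMap.funLeft K K Subtype.val ∘ₗ
      (∑ i, tan 3 (erase S z i) ∘ₗ LinearMap.proj i) ∘ₗ V.subtype
  have hφ (v z t) : φ z v t = ∑ i, tan 3 (erase S z i) (v.1 i) t.1 := by simp [φ]
  have hpoly : ∀ v k, IsPoly fun z => φ z v k := fun v k => by
    simp only [hφ]
    exact IsPoly.sum fun i => isPoly_tan (v := fun _ => v.1 i) (isPoly_erase S i) (fun _ => IsPoly.const _) _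
  have key (z) : IndepOn K S T E z ↔ Function.Injective (φ z) := by
    rw [← LinearMap.ker_eq_bot, LinearMap.ker_eq_bot']
    constructor
    · intro h v hv
      exact Subtype.ext (h v.1 v.2 fun t ht => (hφ v z ⟨t, ht⟩).symm.trans (congrFun hv _))
    · intro h v hT hE
      exact congrArg Subtype.val (h ⟨v, hT⟩ (funext fun t => (hφ _ z t).trans (hE t.1 t.2)))
  simp only [key] at h ⊢
  exact eventually_injective hpoly h

theorem exists_indepOn_of_degenerate [Infinite K] [Fintype σ] [Fintype ι] {S T T₁ T₂ : ι → σ → Prop}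
    {E E₁ E₂ : (Fin 3 → σ) → Prop}
    (h₁ : ∃ z, IndepOn K S T₁ E₁ z) (h₂ : ∃ z, IndepOn K S T₂ E₂ z)
    (hE₁ : ∀ t, E₁ t → E t) (hE₂ : ∀ t, E₂ t → E t) (hT : ∀ i j, T i j → T₁ i j ∨ T₂ i j)
    (hT' : ∀ i t k, T i (t k) → ¬ T₁ i (t k) → E₁ t → ∃ l ≠ k, ¬ S i (t l)) :
    ∃ z, IndepOn K S T E z := by
  classical
  obtain ⟨z, hz₁, hz₂⟩ := ((eventually_indepOn h₁).and (eventually_indepOn h₂)).exists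
  refine ⟨z, fun v hv hvE => ?_⟩
  have h0 : (fun i j => if T₁ i j then v i j else 0) = 0 := by
    refine hz₁ _ (fun i j h => if_neg h) fun t ht => ?_
    refine Eq.trans ?_ (hvE t (hE₁ t ht))
    refine Finset.sum_congr rfl fun i _ => ?_
    simp only [tan_apply, Finset.sum_apply, rankOne_apply]
    refine Finset.sum_congr rfl fun k _ => ?_
    rw [← Finset.mul_prod_erase _ _ (Finset.mem_univ k),
      ← Finset.mul_prod_erase _ _ (Finset.mem_univ k)]
    by_cases h : T i (t k)
    · by_cases h' : T₁ i (t k)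
      · simp only [Function.update_self, if_pos h']
        congr 1
        exact Finset.prod_congr rfl fun l hl => by
          rw [Function.update_of_ne (Finset.ne_of_mem_erase hl),
            Function.update_of_ne (Finset.ne_of_mem_erase hl)]
      · obtain ⟨l, hl, hS⟩ := hT' i t k h h' ht
        have hm : l ∈ Finset.univ.erase k := Finset.mem_erase.2 ⟨hl, Finset.mem_univ _⟩
        rw [Finset.prod_eq_zero hm, Finset.prod_eq_zero hm, mul_zero, mul_zero] <;>
          simp [Function.update_of_ne hl, erase, hS]
    · rw [Function.update_self, Function.update_self, hv _ _ h, ite_self, zero_mul, zero_mul]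
  refine hz₂ v (fun i j h => ?_) fun t ht => hvE t (hE₂ t ht)
  by_cases h' : T i j
  · have := congrFun₂ h0 i j
    rwa [if_pos ((hT i j h').resolve_right h)] at this
  · exact hv i j h'

theorem exists_indepOn_of_injective [Fintype ι] [Fintype ι'] {S T : ι → σ → Prop} {S' T' : ι' → σ' → Prop}
    {E : (Fin 3 → σ) → Prop} {E' : (Fin 3 → σ') → Prop} {e : σ' → σ} {f : ι' → ι}
    (he : Function.Injective e) (hf : Function.Injective f) (h : ∃ z, IndepOn K S' T' E' z)
    (hS : ∀ i j, S' i j → S (f i) (e j))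
    (hT : ∀ i j, T i j → ∃ i' j', f i' = i ∧ e j' = j ∧ T' i' j')
    (hE : ∀ t, E' t → E (e ∘ t)) : ∃ z, IndepOn K S T E z := by
  classical
  obtain ⟨z, hz⟩ := h
  have hef : Function.Injective (Prod.map f e) := hf.prodMap he
  refine ⟨Function.extend (Prod.map f e) (fun k => erase S' z k.1 k.2) 0, fun v hv hvE => ?_⟩
  have hb (i j) : erase S (Function.extend (Prod.map f e) (fun k => erase S' z k.1 k.2) 0)
      (f i) (e j) = erase S' z i j := by
    have := hef.extend_apply (fun k => erase S' z k.1 k.2) 0 (i, j)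
    simp only [Prod.map_apply] at this
    simp only [erase] at this ⊢
    have := hS i j
    split_ifs at * <;> tauto
  have hv0 (i j) (h : ∀ i' j', f i' = i → e j' = j → ¬ T' i' j') : v i j = 0 := hv i j fun hT0 => by
    obtain ⟨i', j', h1, h2, h3⟩ := hT i j hT0
    exact h i' j' h1 h2 h3
  have h0 : (fun i j => v (f i) (e j)) = 0 := by
    refine hz _ (fun i j h => hv0 _ _ fun i' j' h1 h2 => ?_) fun t ht => ?_
    · rwa [hf h1, he h2]
    · refine Eq.trans ?_ (hvE _ (hE t ht))
      rw [← Finset.sum_subset (Finset.subset_univ (Finset.univ.image f)),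
        Finset.sum_image fun _ _ _ _ h => hf h]
      · simp [tan_three, hb]
      · intro i _ hi
        have : v i = 0 := funext fun j => hv0 _ _ fun i' j' h => by simp [← h] at hi
        rw [this, map_zero]
        rfl
  ext i j
  by_contra hne
  obtain ⟨i', j', rfl, rfl, -⟩ := hT i j (by_contra fun h => hne (hv i j h))
  exact hne (congrFun₂ h0 i' j')

theorem independent_iff_indepOn [Fintype ι] : Independent K σ 3 ι ↔
    ∃ z, IndepOn K (fun (_ : ι) (_ : σ) => True) (fun _ _ => True) (fun _ => True) z := by
  have h (z : ι × σ → K) (i : ι) : erase (fun (_ : ι) (_ : σ) => True) z i = fun j => z (i, j) :=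
    funext fun j => if_pos trivial
  constructor
  · rintro ⟨z, hz⟩
    refine ⟨fun k => z k.1 k.2, fun v _ hv => hz v ?_⟩
    ext t
    simpa [h] using hv t trivial
  · rintro ⟨z, hz⟩
    refine ⟨fun i j => z (i, j), fun v hv => hz v (by simp) fun t _ => ?_⟩
    simpa [h] using congrFun hv t

end Degenerate
end SegreVeronese

namespace SegreVeronese

open Filter Module

/-! ### Cubics: degeneration to subspaces of codimension three -/

section Cubic

variable {K : Type} [Field K] {X Y Z W L P P' Q Q' O : Type}

/-- Points indexed by `P` lie in `Y ⊕ Z`, points indexed by `Q` in `X ⊕ Z`, and points indexed by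
`O` in `X ⊕ Y`. -/
def tensorSupp : P ⊕ Q ⊕ O → X ⊕ Y ⊕ Z → Prop
  | .inl _, .inl _ => False
  | .inl _, .inr _ => True
  | .inr (.inl _), .inl _ => True
  | .inr (.inl _), .inr (.inl _) => False
  | .inr (.inl _), .inr (.inr _) => True
  | .inr (.inr _), .inl _ => True
  | .inr (.inr _), .inr (.inl _) => True
  | .inr (.inr _), .inr (.inr _) => False

/-- Points indexed by `P` lie in `Y ⊕ W`, and points indexed by `Q` in `X ⊕ W`. -/
def pairSupp : P ⊕ Q ⊕ O → X ⊕ Y ⊕ W → Prop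
  | .inl _, .inl _ => False
  | .inl _, .inr _ => True
  | .inr (.inl _), .inl _ => True
  | .inr (.inl _), .inr (.inl _) => False
  | .inr (.inl _), .inr (.inr _) => True
  | .inr (.inr _), _ => True

/-- The tangent directions transverse to `Y ⊕ W` for `P`, and to `X ⊕ W` for `Q`. -/
def pairDir : P ⊕ Q ⊕ O → X ⊕ Y ⊕ W → Prop
  | .inl _, .inl _ => True
  | .inl _, .inr _ => False
  | .inr (.inl _), .inl _ => False
  | .inr (.inl _), .inr (.inl _) => True
  | .inr (.inl _), .inr (.inr _) => False
  | .inr (.inr _), _ => True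

/-- Independence of tangent vectors of types `X ⊗ c ⊗ c`, `b ⊗ Y ⊗ b` and `o ⊗ o ⊗ Z` in
`X ⊗ Y ⊗ Z`. -/
def IndepTensor (K X Y Z P Q O : Type) [Field K] [Fintype P] [Fintype Q] [Fintype O] : Prop :=
  ∃ z : (P ⊕ Q ⊕ O) × (X ⊕ Y ⊕ Z) → K, IndepOn K tensorSupp (fun i j => ¬ tensorSupp i j)
    (fun t => (∃ k x, t k = .inl x) ∧ (∃ k y, t k = .inr (.inl y)) ∧ ∃ k z, t k = .inr (.inr z)) z

/-- Independence, modulo cubics not divisible by `X ⊗ Y`, of the tangent spaces at points of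
`Y ⊕ W` (indexed by `P`), of `X ⊕ W` (indexed by `Q`) and of `X ⊕ Y ⊕ W` (indexed by `O`). -/
def IndepOffPair (K X Y W P Q O : Type) [Field K] [Fintype P] [Fintype Q] [Fintype O] : Prop :=
  ∃ z : (P ⊕ Q ⊕ O) × (X ⊕ Y ⊕ W) → K, IndepOn K pairSupp pairDir
    (fun t => (∃ k x, t k = .inl x) ∧ ∃ k y, t k = .inr (.inl y)) z

/-- Independence, modulo cubics on `L`, of the tangent spaces at points of `L` (indexed by `P`)
and of `X ⊕ L` (indexed by `Q`). -/
def IndepOffSubspace (K X L P Q : Type) [Field K] [Fintype P] [Fintype Q] : Prop :=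
  ∃ z : (P ⊕ Q) × (X ⊕ L) → K, IndepOn K (fun i j => i.isRight ∨ j.isRight)
    (fun i j => i.isRight ∨ j.isLeft) (fun t => ∃ k x, t k = .inl x) z

variable [CharZero K] [Fintype X] [Fintype Y] [Fintype Z] [Fintype W] [Fintype L]
  [Fintype P] [Fintype P'] [Fintype Q] [Fintype Q'] [Fintype O]

theorem IndepOffSubspace.independent (h₁ : IndepOffSubspace K X L P Q) (h₂ : Independent K L 3 P) :
    Independent K (X ⊕ L) 3 (P ⊕ Q) := by
  rw [independent_iff_indepOn] at h₂ ⊢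
  refine exists_indepOn_mono (S' := fun i j => i.isRight ∨ j.isRight) (fun _ _ _ => trivial) ?_
  refine exists_indepOn_of_degenerate (T₂ := fun i j => i.isLeft ∧ j.isRight)
    (E₂ := fun t => ∀ k, (t k).isRight) h₁ ?_ (fun _ _ => trivial) (fun _ _ => trivial) ?_ ?_
  · refine exists_indepOn_of_injective (e := Sum.inr) (f := Sum.inl) Sum.inr_injective
      Sum.inl_injective h₂ ?_ ?_ ?_
    · simp
    · simp
    · simp
  · rintro (_ | _) (_ | _) <;> simp
  · rintro (i | i) t k - h ⟨l, x, hx⟩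
    · refine ⟨l, ?_, by simp [hx]⟩
      rintro rfl
      simp [hx] at h
    · simp at h

theorem IndepOffPair.offSubspace (h₁ : IndepOffPair K X Y W P Q O)
    (h₂ : IndepOffSubspace K X W P' Q) :
    IndepOffSubspace K X (Y ⊕ W) (P' ⊕ P) (Q ⊕ O) := by
  let S : (P' ⊕ P) ⊕ Q ⊕ O → X ⊕ Y ⊕ W → Prop := Sum.elim (Sum.elim
    (fun _ => Sum.elim (fun _ => False) (Sum.elim (fun _ => False) fun _ => True))
    (fun _ => Sum.elim (fun _ => False) fun _ => True))
    (Sum.elim (fun _ => Sum.elim (fun _ => True) (Sum.elim (fun _ => False) fun _ => True))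
      fun _ _ => True)
  let T₁ : (P' ⊕ P) ⊕ Q ⊕ O → X ⊕ Y ⊕ W → Prop := Sum.elim (Sum.elim (fun _ _ => False)
    (fun _ => Sum.elim (fun _ => True) fun _ => False))
    (Sum.elim (fun _ => Sum.elim (fun _ => False) (Sum.elim (fun _ => True) fun _ => False))
      fun _ _ => True)
  let T₂ : (P' ⊕ P) ⊕ Q ⊕ O → X ⊕ Y ⊕ W → Prop := Sum.elim (Sum.elim
    (fun _ => Sum.elim (fun _ => True) fun _ => False) (fun _ _ => False))
    (Sum.elim (fun _ => Sum.elim (fun _ => True) (Sum.elim (fun _ => False) fun _ => True))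
      fun _ _ => False)
  refine exists_indepOn_mono (S' := S) ?_ ?_
  · rintro ((_ | _) | (_ | _)) (_ | (_ | _)) <;> simp [S]
  refine exists_indepOn_of_degenerate (T₁ := T₁) (T₂ := T₂)
    (E₁ := fun t => (∃ k x, t k = .inl x) ∧ ∃ k y, t k = .inr (.inl y))
    (E₂ := fun t => (∃ k x, t k = .inl x) ∧ ∀ k y, t k ≠ .inr (.inl y)) ?_ ?_
    (fun t h => h.1) (fun t h => h.1) ?_ ?_
  · refine exists_indepOn_of_injective (e := id) (f := Sum.map Sum.inr id)
      Function.injective_id (Sum.inr_injective.sumMap Function.injective_id) h₁ ?_ ?_ ?_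
    · rintro (_ | (_ | _)) (_ | (_ | _)) <;> simp [S, pairSupp]
    · rintro ((_ | _) | (_ | _)) (_ | (_ | _)) <;> simp [T₁, pairDir]
    · exact fun t h => h
  · refine exists_indepOn_of_injective (e := Sum.map id Sum.inr) (f := Sum.map Sum.inl Sum.inl)
      (Function.injective_id.sumMap Sum.inr_injective)
      (Sum.inl_injective.sumMap Sum.inl_injective) h₂ ?_ ?_ ?_
    · rintro (_ | _) (_ | _) <;> simp [S]
    · rintro ((_ | _) | (_ | _)) (_ | (_ | _)) <;> simp [T₂]
    · rintro t ⟨k, x, hx⟩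
      refine ⟨⟨k, x, by simp [hx]⟩, fun l y => ?_⟩
      rcases h : t l with _ | _ <;> simp [h]
  · rintro ((_ | _) | (_ | _)) (_ | (_ | _)) <;> simp [T₁, T₂]
  · rintro i t k h h' ⟨-, l, y, hy⟩
    refine ⟨l, ?_, ?_⟩
    · rintro rfl
      rw [hy] at h h'
      rcases i with ((_ | _) | (_ | _)) <;> simp [T₁] at h h'
    · rw [hy]
      rcases i with ((_ | _) | (_ | _)) <;> generalize t k = j at * <;>
        rcases j with (_ | (_ | _)) <;> simp [S, T₁] at h h' ⊢

set_option maxHeartbeats 1600000 in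
theorem IndepTensor.offPair (h₁ : IndepTensor K X Y Z P Q O)
    (h₂ : IndepOffPair K X Y W P' Q' O) :
    IndepOffPair K X Y (Z ⊕ W) (P' ⊕ P) (Q' ⊕ Q) O := by
  let S : (P' ⊕ P) ⊕ (Q' ⊕ Q) ⊕ O → X ⊕ Y ⊕ Z ⊕ W → Prop := Sum.elim (Sum.elim
    (fun _ => Sum.elim (fun _ => False) (Sum.elim (fun _ => True) fun w => w.isRight))
    (fun _ => Sum.elim (fun _ => False) (Sum.elim (fun _ => True) fun w => w.isLeft)))
    (Sum.elim (Sum.elim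
      (fun _ => Sum.elim (fun _ => True) (Sum.elim (fun _ => False) fun w => w.isRight))
      (fun _ => Sum.elim (fun _ => True) (Sum.elim (fun _ => False) fun w => w.isLeft)))
      fun _ => Sum.elim (fun _ => True) (Sum.elim (fun _ => True) fun w => w.isRight))
  let T₁ : (P' ⊕ P) ⊕ (Q' ⊕ Q) ⊕ O → X ⊕ Y ⊕ Z ⊕ W → Prop := Sum.elim (Sum.elim
    (fun _ _ => False)
    (fun _ => Sum.elim (fun _ => True) fun _ => False))
    (Sum.elim (Sum.elim (fun _ _ => False)
      (fun _ => Sum.elim (fun _ => False) (Sum.elim (fun _ => True) fun _ => False)))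
      fun _ => Sum.elim (fun _ => False) (Sum.elim (fun _ => False) fun w => w.isLeft))
  let T₂ : (P' ⊕ P) ⊕ (Q' ⊕ Q) ⊕ O → X ⊕ Y ⊕ Z ⊕ W → Prop := Sum.elim (Sum.elim
    (fun _ => Sum.elim (fun _ => True) fun _ => False) (fun _ _ => False))
    (Sum.elim (Sum.elim
      (fun _ => Sum.elim (fun _ => False) (Sum.elim (fun _ => True) fun _ => False))
      (fun _ _ => False))
      fun _ => Sum.elim (fun _ => True) (Sum.elim (fun _ => True) fun w => w.isRight))
  refine exists_indepOn_mono (S' := S) ?_ ?_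
  · rintro ((_ | _) | ((_ | _) | _)) (_ | (_ | (_ | _))) <;> simp [S, pairSupp]
  refine exists_indepOn_of_degenerate (T₁ := T₁) (T₂ := T₂)
    (E₁ := fun t => (∃ k x, t k = .inl x) ∧ (∃ k y, t k = .inr (.inl y)) ∧
      ∃ k z, t k = .inr (.inr (.inl z)))
    (E₂ := fun t => (∃ k x, t k = .inl x) ∧ (∃ k y, t k = .inr (.inl y))) ?_ ?_
    (fun t h => ⟨h.1, h.2.1⟩) (fun t h => h) ?_ ?_
  · refine exists_indepOn_of_injective (e := Sum.map id (Sum.map id Sum.inl))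
      (f := Sum.map Sum.inr (Sum.map Sum.inr id))
      (Function.injective_id.sumMap (Function.injective_id.sumMap Sum.inl_injective))
      (Sum.inr_injective.sumMap (Sum.inr_injective.sumMap Function.injective_id)) h₁ ?_ ?_ ?_
    · rintro (_ | (_ | _)) (_ | (_ | _)) <;> simp [S, tensorSupp]
    · rintro ((_ | _) | ((_ | _) | _)) (_ | (_ | (_ | _))) <;> simp [T₁, tensorSupp]
    · rintro t ⟨⟨k, x, hx⟩, ⟨l, y, hy⟩, m, z, hz⟩
      exact ⟨⟨k, x, by simp [hx]⟩, ⟨l, y, by simp [hy]⟩, m, z, by simp [hz]⟩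
  · refine exists_indepOn_of_injective (e := Sum.map id (Sum.map id Sum.inr))
      (f := Sum.map Sum.inl (Sum.map Sum.inl id))
      (Function.injective_id.sumMap (Function.injective_id.sumMap Sum.inr_injective))
      (Sum.inl_injective.sumMap (Sum.inl_injective.sumMap Function.injective_id)) h₂ ?_ ?_ ?_
    · rintro (_ | (_ | _)) (_ | (_ | _)) <;> simp [S, pairSupp]
    · rintro ((_ | _) | ((_ | _) | _)) (_ | (_ | (_ | _))) <;> simp [T₂, pairDir]
    · rintro t ⟨⟨k, x, hx⟩, l, y, hy⟩
      exact ⟨⟨k, x, by simp [hx]⟩, l, y, by simp [hy]⟩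
  · rintro ((_ | _) | ((_ | _) | _)) (_ | (_ | (_ | _))) <;> simp [T₁, T₂, pairDir]
  · rintro i t k h h' ⟨⟨l₁, x, hx⟩, ⟨l₂, y, hy⟩, l₃, z, hz⟩
    rcases i with ((i | i) | ((i | i) | i))
    · refine ⟨l₃, ?_, by simp [S, hz]⟩
      rintro rfl
      simp [hz, pairDir] at h
    · rcases hj : t k with (_ | (_ | (_ | _))) <;> simp [T₁, hj, pairDir] at h h'
    · refine ⟨l₃, ?_, by simp [S, hz]⟩
      rintro rfl
      simp [hz, pairDir] at h
    · rcases hj : t k with (_ | (_ | (_ | _))) <;> simp [T₁, hj, pairDir] at h h'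
    · refine ⟨l₃, ?_, by simp [S, hz]⟩
      rintro rfl
      simp [hz, T₁] at h'

end Cubic
end SegreVeronese

namespace SegreVeronese

open Filter Module

variable {K : Type} [Field K]

theorem indepOffPair_of_equations {X Y W P Q O : Type} [Fintype P] [Fintype Q] [Fintype O]
    (cY : P → Y → K) (cW : P → W → K) (bX : Q → X → K) (bW : Q → W → K) (oX : O → X → K)
    (oY : O → Y → K) (oW : O → W → K)
    (h : ∀ (ξ : P → X → K) (η : Q → Y → K) (vX : O → X → K) (vY : O → Y → K) (vW : O → W → K),
    (∀ x x' y, ∑ q, bX q x * bX q x' * η q y + ∑ o, (vX o x * oX o x' * oY o y +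
      oX o x * vX o x' * oY o y + oX o x * oX o x' * vY o y) = 0) →
    (∀ x y y', ∑ p, ξ p x * cY p y * cY p y' + ∑ o, (vX o x * oY o y * oY o y' +
      oX o x * vY o y * oY o y' + oX o x * oY o y * vY o y') = 0) →
    (∀ x y w, ∑ p, ξ p x * cY p y * cW p w + ∑ q, bX q x * η q y * bW q w +
      ∑ o, (vX o x * oY o y * oW o w + oX o x * vY o y * oW o w +
        oX o x * oY o y * vW o w) = 0) →
    ξ = 0 ∧ η = 0 ∧ vX = 0 ∧ vY = 0 ∧ vW = 0) : IndepOffPair K X Y W P Q O := by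
  refine ⟨fun k => Sum.elim (γ := X ⊕ Y ⊕ W → K) (fun p => Sum.elim (fun _ => 0) (Sum.elim (cY p) (cW p)))
      (Sum.elim (fun q => Sum.elim (bX q) (Sum.elim (fun _ => 0) (bW q)))
        fun o => Sum.elim (oX o) (Sum.elim (oY o) (oW o))) k.1 k.2, fun v hT hE => ?_⟩
  have hpY (p y) : v (.inl p) (.inr y) = 0 := hT _ _ id
  have hqX (q x) : v (.inr (.inl q)) (.inl x) = 0 := hT _ _ id
  have hqW (q w) : v (.inr (.inl q)) (.inr (.inr w)) = 0 := hT _ _ id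
  obtain ⟨h1, h2, h3, h4, h5⟩ := h (fun p x => v (.inl p) (.inl x))
    (fun q y => v (.inr (.inl q)) (.inr (.inl y))) (fun o x => v (.inr (.inr o)) (.inl x))
    (fun o y => v (.inr (.inr o)) (.inr (.inl y))) (fun o w => v (.inr (.inr o)) (.inr (.inr w)))
    (fun x x' y => by
      simpa [tan_three, erase, pairSupp, hpY, hqX, hqW] using
        hE ![.inl x, .inl x', .inr (.inl y)] ⟨⟨0, x, rfl⟩, 2, y, rfl⟩)
    (fun x y y' => by
      simpa [tan_three, erase, pairSupp, hpY, hqX, hqW] using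
        hE ![.inl x, .inr (.inl y), .inr (.inl y')] ⟨⟨0, x, rfl⟩, 1, y, rfl⟩)
    (fun x y w => by
      simpa [tan_three, erase, pairSupp, hpY, hqX, hqW, add_assoc] using
        hE ![.inl x, .inr (.inl y), .inr (.inr w)] ⟨⟨0, x, rfl⟩, 1, y, rfl⟩)
  ext i j
  rcases i with p | q | o <;> rcases j with x | y | w
  · exact congrFun₂ h1 p x
  · exact hpY _ _
  · exact hpY _ _
  · exact hqX _ _
  · exact congrFun₂ h2 q y
  · exact hqW _ _
  · exact congrFun₂ h3 o x
  · exact congrFun₂ h4 o y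
  · exact congrFun₂ h5 o w

variable [CharZero K]

theorem indepOffPair_zero : IndepOffPair K (Fin 3) (Fin 3) (Fin 0) (Fin 3) (Fin 3) (Fin 3) := by
  refine indepOffPair_of_equations ![![1, 0, 0], ![0, 1, 0], ![0, 0, 1]] 0
    ![![1, 0, 0], ![0, 1, 0], ![0, 0, 1]] 0 ![![0, 1, 1], ![1, 0, -1], ![-1, -1, 0]]
    ![![1, 0, 1], ![1, 1, 0], ![0, 1, 1]] 0 fun ξ η vX vY vW h1 h2 h3 => ?_
  have key : ∀ i j, vX i j = 0 ∧ vY i j = 0 := by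
    have e1 := fun y => And.intro (h1 0 1 y) (And.intro (h1 0 2 y) (h1 1 2 y))
    have e2 := fun x => And.intro (h2 x 0 1) (And.intro (h2 x 0 2) (h2 x 1 2))
    clear h1 h2 h3
    simp [Fin.forall_fin_succ, Fin.sum_univ_three] at e1 e2
    have : vX 0 0 = 0 := by grind (ringSteps := 100000)
    have : vX 0 1 = 0 := by grind (ringSteps := 100000)
    have : vX 0 2 = 0 := by grind (ringSteps := 100000)
    have : vX 1 0 = 0 := by grind (ringSteps := 100000)
    have : vX 1 1 = 0 := by grind (ringSteps := 100000)
    have : vX 1 2 = 0 := by grind (ringSteps := 100000)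
    have : vX 2 0 = 0 := by grind (ringSteps := 100000)
    have : vX 2 1 = 0 := by grind (ringSteps := 100000)
    have : vX 2 2 = 0 := by grind (ringSteps := 100000)
    simp only [Fin.forall_fin_succ]
    simp_all
  simp only [key, Fin.sum_univ_three] at h1 h2
  refine ⟨funext₂ fun p x => ?_, funext₂ fun q y => ?_, funext₂ fun o x => (key o x).1,
    funext₂ fun o y => (key o y).2, Subsingleton.elim _ _⟩
  · have := h2 x p p
    fin_cases p <;> simpa using this
  · have := h1 q q y
    fin_cases q <;> simpa using this

theorem indepOffPair_one : IndepOffPair K (Fin 3) (Fin 3) (Fin 1) (Fin 4) (Fin 4) (Fin 3) := by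
  refine indepOffPair_of_equations ![![1, 1, 1], ![1, 0, 0], ![0, 1, 0], ![0, 0, 1]]
    ![![0], ![0], ![0], ![0]]
    ![![0, 0, -1], ![1, 0, 0], ![0, 1, 0], ![0, 0, 1]]
    ![![-1], ![0], ![0], ![0]]
    ![![1, 1, 0], ![0, 1, 1], ![1, 0, -1]] ![![0, 1, 1], ![1, 1, 0], ![1, 0, 1]]
    ![![1], ![0], ![-1]] fun ξ η vX vY vW h1 h2 h3 => ?_
  have key : (∀ o, (∀ j, vX o j = 0) ∧ (∀ j, vY o j = 0) ∧ ∀ j, vW o j = 0) ∧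
      (∀ j, ξ 0 j = 0) ∧ ∀ j, η 0 j = 0 := by
    have e1 := fun y => And.intro (h1 0 1 y) (And.intro (h1 0 2 y) (h1 1 2 y))
    have e2 := fun x => And.intro (h2 x 0 1) (And.intro (h2 x 0 2) (h2 x 1 2))
    clear h1 h2
    simp [Fin.forall_fin_succ, Fin.sum_univ_succ] at e1 e2 h3
    have : ξ 0 0 = 0 := by grind (ringSteps := 100000)
    have : ξ 0 1 = 0 := by grind (ringSteps := 100000)
    have : ξ 0 2 = 0 := by grind (ringSteps := 100000)
    have : η 0 0 = 0 := by grind (ringSteps := 100000)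
    have : η 0 1 = 0 := by grind (ringSteps := 100000)
    have : η 0 2 = 0 := by grind (ringSteps := 100000)
    have : vX 0 0 = 0 := by grind (ringSteps := 100000)
    have : vX 0 1 = 0 := by grind (ringSteps := 100000)
    have : vX 0 2 = 0 := by grind (ringSteps := 100000)
    have : vX 1 0 = 0 := by grind (ringSteps := 100000)
    have : vX 1 1 = 0 := by grind (ringSteps := 100000)
    have : vX 1 2 = 0 := by grind (ringSteps := 100000)
    have : vX 2 0 = 0 := by grind (ringSteps := 100000)
    have : vX 2 1 = 0 := by grind (ringSteps := 100000)
    have : vX 2 2 = 0 := by grind (ringSteps := 100000)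
    have : vW 0 0 = 0 := by grind (ringSteps := 100000)
    have : vW 1 0 = 0 := by grind (ringSteps := 100000)
    have : vW 2 0 = 0 := by grind (ringSteps := 100000)
    simp only [Fin.forall_fin_succ]
    simp_all
  clear h3
  simp only [key, Fin.sum_univ_succ] at h1 h2
  refine ⟨funext₂ fun p x => ?_, funext₂ fun q y => ?_, funext₂ fun o x => (key.1 o).1 x,
    funext₂ fun o y => (key.1 o).2.1 y, funext₂ fun o w => (key.1 o).2.2 w⟩
  · have e0 := h2 x 0 0
    have e1 := h2 x 1 1
    have e2 := h2 x 2 2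
    clear h1 h2
    simp at e0 e1 e2
    fin_cases p <;> simp [*]
  · have e0 := h1 0 0 y
    have e1 := h1 1 1 y
    have e2 := h1 2 2 y
    clear h1 h2
    simp at e0 e1 e2
    fin_cases q <;> simp [*]

set_option maxHeartbeats 1000000 in
theorem indepOffPair_two : IndepOffPair K (Fin 3) (Fin 3) (Fin 2) (Fin 5) (Fin 5) (Fin 3) := by
  refine indepOffPair_of_equations ![![0, 0, -1], ![-1, 1, 1], ![1, 0, 0], ![0, 1, 0], ![0, 0, 1]]
    ![![1, 0], ![0, -1], ![0, 0], ![0, 0], ![0, 0]]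
    ![![1, 0, 1], ![1, 0, 0], ![1, 0, 0], ![0, 1, 0], ![0, 0, 1]]
    ![![0, -1], ![1, 1], ![0, 0], ![0, 0], ![0, 0]]
    ![![0, 1, 1], ![-1, 1, 1], ![0, -1, 1]] ![![1, 1, 0], ![0, 1, -1], ![1, 0, 1]]
    ![![-1, 0], ![0, -1], ![0, -1]] fun ξ η vX vY vW h1 h2 h3 => ?_
  have key : (∀ o, (∀ j, vX o j = 0) ∧ (∀ j, vY o j = 0) ∧ ∀ j, vW o j = 0) ∧
      (∀ j, ξ 0 j = 0) ∧ (∀ j, ξ 1 j = 0) ∧ (∀ j, η 0 j = 0) ∧ ∀ j, η 1 j = 0 := by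
    have e1 := fun y => And.intro (h1 0 1 y) (And.intro (h1 0 2 y) (h1 1 2 y))
    have e2 := fun x => And.intro (h2 x 0 1) (And.intro (h2 x 0 2) (h2 x 1 2))
    clear h1 h2
    simp [Fin.forall_fin_succ, Fin.sum_univ_succ] at e1 e2 h3
    have : ξ 0 0 = 0 := by grind (ringSteps := 100000)
    have : ξ 0 1 = 0 := by grind (ringSteps := 100000)
    have : ξ 0 2 = 0 := by grind (ringSteps := 100000)
    have : ξ 1 0 = 0 := by grind (ringSteps := 100000)
    have : ξ 1 1 = 0 := by grind (ringSteps := 100000)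
    have : ξ 1 2 = 0 := by grind (ringSteps := 100000)
    have : η 0 0 = 0 := by grind (ringSteps := 100000)
    have : η 0 1 = 0 := by grind (ringSteps := 100000)
    have : η 0 2 = 0 := by grind (ringSteps := 100000)
    have : η 1 0 = 0 := by grind (ringSteps := 100000)
    have : η 1 1 = 0 := by grind (ringSteps := 100000)
    have : η 1 2 = 0 := by grind (ringSteps := 100000)
    have : vX 0 0 = 0 := by grind (ringSteps := 100000)
    have : vX 0 1 = 0 := by grind (ringSteps := 100000)
    have : vX 0 2 = 0 := by grind (ringSteps := 100000)
    have : vX 1 0 = 0 := by grind (ringSteps := 100000)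
    have : vX 1 1 = 0 := by grind (ringSteps := 100000)
    have : vX 1 2 = 0 := by grind (ringSteps := 100000)
    have : vX 2 0 = 0 := by grind (ringSteps := 100000)
    have : vX 2 1 = 0 := by grind (ringSteps := 100000)
    have : vX 2 2 = 0 := by grind (ringSteps := 100000)
    have : vW 0 0 = 0 := by grind (ringSteps := 100000)
    have : vW 0 1 = 0 := by grind (ringSteps := 100000)
    have : vW 1 0 = 0 := by grind (ringSteps := 100000)
    have : vW 1 1 = 0 := by grind (ringSteps := 100000)
    have : vW 2 0 = 0 := by grind (ringSteps := 100000)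
    have : vW 2 1 = 0 := by grind (ringSteps := 100000)
    simp only [Fin.forall_fin_succ]
    simp_all
  clear h3
  simp only [key, Fin.sum_univ_succ] at h1 h2
  refine ⟨funext₂ fun p x => ?_, funext₂ fun q y => ?_, funext₂ fun o x => (key.1 o).1 x,
    funext₂ fun o y => (key.1 o).2.1 y, funext₂ fun o w => (key.1 o).2.2 w⟩
  · have e0 := h2 x 0 0
    have e1 := h2 x 1 1
    have e2 := h2 x 2 2
    clear h1 h2
    simp [key] at e0 e1 e2
    fin_cases p <;> simp [*]
  · have e0 := h1 0 0 y
    have e1 := h1 1 1 y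
    have e2 := h1 2 2 y
    clear h1 h2
    simp [key] at e0 e1 e2
    fin_cases q <;> simp [*]

end SegreVeronese

namespace SegreVeronese

open Filter Module

variable {K : Type} [Field K]

theorem indepTensor_of_equations {X Y Z P Q O : Type} [Fintype P] [Fintype Q] [Fintype O]
    (cY : P → Y → K) (cZ : P → Z → K) (bX : Q → X → K) (bZ : Q → Z → K) (oX : O → X → K)
    (oY : O → Y → K)
    (h : ∀ (ξ : P → X → K) (η : Q → Y → K) (ζ : O → Z → K),
    (∀ x y z, ∑ p, ξ p x * cY p y * cZ p z + ∑ q, bX q x * η q y * bZ q z +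
      ∑ o, oX o x * oY o y * ζ o z = 0) → ξ = 0 ∧ η = 0 ∧ ζ = 0) :
    IndepTensor K X Y Z P Q O := by
  refine ⟨fun k => Sum.elim (γ := X ⊕ Y ⊕ Z → K)
      (fun p => Sum.elim (fun _ => 0) (Sum.elim (cY p) (cZ p)))
      (Sum.elim (fun q => Sum.elim (bX q) (Sum.elim (fun _ => 0) (bZ q)))
        fun o => Sum.elim (oX o) (Sum.elim (oY o) (fun _ => 0))) k.1 k.2, fun v hT hE => ?_⟩
  have hp (p j) : v (.inl p) (.inr j) = 0 := hT _ _ fun h => h trivial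
  have hqX (q x) : v (.inr (.inl q)) (.inl x) = 0 := hT _ _ fun h => h trivial
  have hqZ (q z) : v (.inr (.inl q)) (.inr (.inr z)) = 0 := hT _ _ fun h => h trivial
  have hoX (q x) : v (.inr (.inr q)) (.inl x) = 0 := hT _ _ fun h => h trivial
  have hoY (q y) : v (.inr (.inr q)) (.inr (.inl y)) = 0 := hT _ _ fun h => h trivial
  obtain ⟨h1, h2, h3⟩ := h (fun p x => v (.inl p) (.inl x))
    (fun q y => v (.inr (.inl q)) (.inr (.inl y))) (fun o z => v (.inr (.inr o)) (.inr (.inr z)))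
    (fun x y z => by
      simpa [tan_three, erase, tensorSupp, hp, hqX, hqZ, hoX, hoY, add_assoc] using
        hE ![.inl x, .inr (.inl y), .inr (.inr z)] ⟨⟨0, x, rfl⟩, ⟨1, y, rfl⟩, 2, z, rfl⟩)
  ext i j
  rcases i with p | q | o <;> rcases j with x | y | z
  · exact congrFun₂ h1 p x
  · exact hp _ _
  · exact hp _ _
  · exact hqX _ _
  · exact congrFun₂ h2 q y
  · exact hqZ _ _
  · exact hoX _ _
  · exact hoY _ _
  · exact congrFun₂ h3 o z

theorem indepOffSubspace_of_equations {X L P Q : Type} [Fintype P] [Fintype Q]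
    (c : P → L → K) (bX : Q → X → K) (bL : Q → L → K)
    (h : ∀ (ξ : P → X → K) (vX : Q → X → K) (vL : Q → L → K),
    (∀ x x' x'', ∑ q, (vX q x * bX q x' * bX q x'' + bX q x * vX q x' * bX q x'' +
      bX q x * bX q x' * vX q x'') = 0) →
    (∀ x x' l, ∑ q, (vX q x * bX q x' * bL q l + bX q x * vX q x' * bL q l +
      bX q x * bX q x' * vL q l) = 0) →
    (∀ x l l', ∑ p, ξ p x * c p l * c p l' + ∑ q, (vX q x * bL q l * bL q l' +
      bX q x * vL q l * bL q l' + bX q x * bL q l * vL q l') = 0) →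
    ξ = 0 ∧ vX = 0 ∧ vL = 0) : IndepOffSubspace K X L P Q := by
  refine ⟨fun k => Sum.elim (γ := X ⊕ L → K) (fun p => Sum.elim (fun _ => 0) (c p))
      (fun q => Sum.elim (bX q) (bL q)) k.1 k.2, fun v hT hE => ?_⟩
  have hp (p j) : v (.inl p) (.inr j) = 0 := hT _ _ (by simp)
  obtain ⟨h1, h2, h3⟩ := h (fun p x => v (.inl p) (.inl x))
    (fun q x => v (.inr q) (.inl x)) (fun q l => v (.inr q) (.inr l))
    (fun x x' x'' => by
      simpa [tan_three, erase, hp] using hE ![.inl x, .inl x', .inl x''] ⟨0, x, rfl⟩)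
    (fun x x' l => by
      simpa [tan_three, erase, hp] using hE ![.inl x, .inl x', .inr l] ⟨0, x, rfl⟩)
    (fun x l l' => by
      simpa [tan_three, erase, hp, add_assoc] using hE ![.inl x, .inr l, .inr l'] ⟨0, x, rfl⟩)
  ext i j
  rcases i with p | q <;> rcases j with x | l
  · exact congrFun₂ h1 p x
  · exact hp _ _
  · exact congrFun₂ h2 q x
  · exact congrFun₂ h3 q l

variable [CharZero K]

theorem indepTensor_three :
    IndepTensor K (Fin 3) (Fin 3) (Fin 3) (Fin 3) (Fin 3) (Fin 3) := by
  refine indepTensor_of_equations ![![1, 0, 0], ![0, 1, 0], ![0, 0, 1]]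
    ![![1, 0, 0], ![0, 1, 0], ![0, 0, 1]] ![![1, 0, 0], ![0, 1, 0], ![0, 0, 1]]
    ![![1, 1, 0], ![0, -1, 1], ![1, 1, 1]] ![![0, 1, 1], ![1, 1, 0], ![1, 0, 1]]
    ![![1, 1, 0], ![1, 0, 1], ![0, 1, 1]] fun ξ η ζ h => ?_
  simp [Fin.forall_fin_succ, Fin.sum_univ_three] at h
  have h1 : ∀ i j, ζ i j = 0 := by
    have : ζ 0 0 = 0 := by grind (ringSteps := 100000)
    have : ζ 0 1 = 0 := by grind (ringSteps := 100000)
    have : ζ 0 2 = 0 := by grind (ringSteps := 100000)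
    have : ζ 1 0 = 0 := by grind (ringSteps := 100000)
    have : ζ 1 1 = 0 := by grind (ringSteps := 100000)
    have : ζ 1 2 = 0 := by grind (ringSteps := 100000)
    have : ζ 2 0 = 0 := by grind (ringSteps := 100000)
    have : ζ 2 1 = 0 := by grind (ringSteps := 100000)
    have : ζ 2 2 = 0 := by grind (ringSteps := 100000)
    simp [Fin.forall_fin_succ, *]
  have h2 : ∀ i j, ξ i j = 0 ∧ η i j = 0 := by
    simp [Fin.forall_fin_succ]
    simp [h1] at h
    grind
  exact ⟨funext₂ fun i j => (h2 i j).1, funext₂ fun i j => (h2 i j).2, funext₂ h1⟩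

theorem indepOffSubspace_zero : IndepOffSubspace K (Fin 3) (Fin 0) (Fin 0) (Fin 3) := by
  refine indepOffSubspace_of_equations 0 ![![1, 0, 0], ![0, 1, 0], ![0, 0, 1]] 0
    fun ξ vX vL h1 h2 h3 => ?_
  refine ⟨Subsingleton.elim _ _, ?_, Subsingleton.elim _ _⟩
  have e1 := fun x y => h1 x x y
  simp [Fin.forall_fin_succ, Fin.sum_univ_three] at e1
  have : ∀ i j, vX i j = 0 := by
    simp only [Fin.forall_fin_succ]
    grind
  exact funext₂ this

theorem indepOffSubspace_one : IndepOffSubspace K (Fin 3) (Fin 1) (Fin 0) (Fin 4) := by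
  refine indepOffSubspace_of_equations 0 ![![1, 1, 1], ![1, 0, 0], ![0, 1, 0], ![0, 0, 1]]
    ![![1], ![0], ![0], ![0]] fun ξ vX vL h1 h2 h3 => ?_
  have h4 := fun x x' => h2 x x' 0
  have h5 := fun x => h3 x 0 0
  have key : (∀ i j, vX i j = 0) ∧ ∀ i, vL i 0 = 0 := by
    clear h2 h3
    simp [Fin.forall_fin_succ, Fin.sum_univ_succ] at h1 h4 h5
    simp [Fin.forall_fin_succ]
    grind (splits := 20)
  refine ⟨Subsingleton.elim _ _, funext₂ key.1, funext₂ fun q l => ?_⟩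
  rw [Subsingleton.elim l 0]
  exact key.2 q

theorem indepOffSubspace_two : IndepOffSubspace K (Fin 3) (Fin 2) (Fin 0) (Fin 5) := by
  refine indepOffSubspace_of_equations 0
    ![![1, 1, 1], ![1, 2, 3], ![1, 0, 0], ![0, 1, 0], ![0, 0, 1]]
    ![![1, 0], ![0, 1], ![0, 0], ![0, 0], ![0, 0]] fun ξ vX vL h1 h2 h3 => ?_
  have key : (∀ i j, vX i j = 0) ∧ ∀ i j, vL i j = 0 := by
    simp [Fin.forall_fin_succ, Fin.sum_univ_succ] at h1 h2 h3
    simp [Fin.forall_fin_succ]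
    grind (splits := 20)
  exact ⟨Subsingleton.elim _ _, funext₂ key.1, funext₂ key.2⟩

end SegreVeronese

namespace SegreVeronese

open Filter Module

variable {K : Type} [Field K]

theorem independent_of_isEmpty {σ ι : Type} [Fintype ι] [IsEmpty ι] {d : ℕ} :
    Independent K σ d ι :=
  ⟨isEmptyElim, fun _ _ => Subsingleton.elim _ _⟩

theorem Independent.of_equiv {σ σ' ι : Type} [Fintype ι] {d : ℕ} (h : Independent K σ d ι)
    (e : σ' ≃ σ) : Independent K σ' d ι := by
  obtain ⟨z, hz⟩ := h
  refine ⟨fun i => z i ∘ e, fun v hv => ?_⟩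
  have := hz (fun i => v i ∘ e.symm) (funext fun t => by
    have := congrFun hv (e.symm ∘ t)
    simp only [Finset.sum_apply, tan_apply, rankOne_apply, Pi.zero_apply] at this ⊢
    rw [← this]
    refine Finset.sum_congr rfl fun i _ => Finset.sum_congr rfl fun k _ =>
      Finset.prod_congr rfl fun l _ => ?_
    by_cases h : l = k
    · subst h
      simp
    · simp [Function.update_of_ne h])
  ext i j
  simpa using congrFun₂ this i (e j)

/-- A system of cubics in `n` variables on which the induction in steps of three variables
operates. -/
def CubicStep (K : Type) [Field K] (n : ℕ) : Prop :=
  ∃ (W P H : Type) (_ : Fintype W) (_ : Fintype P) (_ : Fintype H), Fintype.card W = n ∧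
    (n * (n + 3) ≤ 6 * Fintype.card H + 10 ∧ (n % 3 = 1 → n * (n + 3) ≤ 6 * Fintype.card H + 4) ∧
      (n % 3 = 0 → n * (n + 3) ≤ 6 * Fintype.card H)) ∧ Fintype.card P = n + 3 ∧
    Independent K W 3 H ∧ IndepOffSubspace K (Fin 3) W H P ∧
    IndepOffPair K (Fin 3) (Fin 3) W P P (Fin 3)

variable [CharZero K]

theorem CubicStep.add_three {n : ℕ} (h : CubicStep K n) : CubicStep K (n + 3) := by
  obtain ⟨W, P, H, _, _, _, hW, hH, hP, hA, hB, hC⟩ := h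
  refine ⟨Fin 3 ⊕ W, P ⊕ Fin 3, H ⊕ P, inferInstance, inferInstance, inferInstance, ?_, ?_, ?_,
    hB.independent hA, hC.offSubspace hB, indepTensor_three.offPair hC⟩
  · simp [hW, add_comm]
  · simp only [Fintype.card_sum, hP, Nat.add_mod_right]
    have e : (n + 3) * (n + 3 + 3) = n * (n + 3) + 6 * (n + 3) := by ring
    rw [e]
    omega
  · simp [hP]

theorem cubicStep (n : ℕ) : CubicStep K n := by
  induction n using Nat.strong_induction_on with
  | _ n ih =>
    match n, ih with
    | 0, _ => exact ⟨Fin 0, Fin 3, Fin 0, inferInstance, inferInstance, inferInstance, rfl,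
        by simp, rfl, independent_of_isEmpty, indepOffSubspace_zero, indepOffPair_zero⟩
    | 1, _ => exact ⟨Fin 1, Fin 4, Fin 0, inferInstance, inferInstance, inferInstance, rfl,
        by simp, rfl, independent_of_isEmpty, indepOffSubspace_one, indepOffPair_one⟩
    | 2, _ => exact ⟨Fin 2, Fin 5, Fin 0, inferInstance, inferInstance, inferInstance, rfl,
        by simp, rfl, independent_of_isEmpty, indepOffSubspace_two, indepOffPair_two⟩
    | n + 3, ih => exact (ih n (by omega)).add_three

/-- Subabundant cubics: general tangent spaces to the Veronese cone are independent. -/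
theorem independent_three {m h : ℕ} (hh : h * (m + 2) ≤ (m + 3).choose 3) (hm : 1 ≤ m) :
    Independent K (Fin (m + 1)) 3 (Fin h) := by
  obtain rfl | hm := hm.eq_or_lt
  · exact independent_binary_cubics hh
  obtain ⟨W, P, H, _, _, _, hW, ⟨h1, h2, h3⟩, -, hA, -, -⟩ := cubicStep (K := K) (m + 1)
  refine (hA.of_card_le ?_).of_equiv (Fintype.equivFinOfCardEq hW).symm
  rw [Fintype.card_fin]
  have h4 : (m + 3).choose 3 * 6 = (m + 1) * (m + 2) * (m + 3) := by
    have := Nat.ascFactorial_eq_factorial_mul_choose m 3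
    simp only [Nat.ascFactorial, Nat.factorial] at this
    linarith
  have h5 : h * 6 ≤ (m + 1) * (m + 3) := by
    refine Nat.le_of_mul_le_mul_right (c := m + 2) ?_ (by omega)
    nlinarith
  have h6 : (m + 1) * (m + 1 + 3) = (m + 1) * (m + 3) + (m + 1) := by ring
  rw [h6] at h1 h2 h3
  generalize (m + 1) * (m + 3) = A at *
  generalize Fintype.card H = B at *
  by_cases hm4 : 4 ≤ m
  · omega
  · interval_cases m
    · have := h3 rfl
      omega
    · have := h2 rfl
      omega

theorem independent_of_three_le {m d h : ℕ} (hd : 3 ≤ d) (hm : 1 ≤ m)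
    (hh : h * (m + 2) ≤ (m + d).choose d) : Independent K (Fin (m + 1)) d (Fin h) := by
  obtain rfl | hd := hd.eq_or_lt
  · exact independent_three hh hm
  · exact independent_of_four_le hd hh

end SegreVeronese

namespace SegreVeronese

open Filter Module

/-! ### The Jacobian criterion for algebraic independence -/

section Jacobian

theorem derivation_aeval {R A ι : Type*} [CommRing R] [CommRing A] [Algebra R A] [Fintype ι]
    (D : Derivation R A A) (q : ι → A) (F : MvPolynomial ι R) :
    D (aeval q F) = ∑ i, aeval q (pderiv i F) * D (q i) := by
  classical
  induction F using MvPolynomial.induction_on with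
  | C a => simp
  | add p p' hp hp' => simp only [map_add, hp, hp', add_mul, Finset.sum_add_distrib]
  | mul_X p i hp =>
    simp only [map_mul, aeval_X, Derivation.leibniz, hp, smul_eq_mul, pderiv_X, map_add, add_mul,
      Finset.sum_add_distrib, Finset.mul_sum]
    congr 1
    · rw [Finset.sum_eq_single i] <;> simp +contextual
    · exact Finset.sum_congr rfl fun j _ => by ring

theorem eq_C_of_pderiv_eq_zero {K ι : Type*} [Field K] [CharZero K] {F : MvPolynomial ι K}
    (h : ∀ i, pderiv i F = 0) : F = C (coeff 0 F) := by
  classical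
  ext m
  rw [coeff_C]
  split_ifs with hm
  · rw [hm]
  · obtain ⟨i, hi⟩ := Finsupp.ne_iff.1 (Ne.symm hm)
    have h1 := congrArg (coeff (m - Finsupp.single i 1)) (h i)
    have hle : Finsupp.single i 1 ≤ m := by
      rw [Finsupp.single_le_iff]
      exact Nat.one_le_iff_ne_zero.2 hi
    rw [coeff_pderiv, tsub_add_cancel_of_le hle, coeff_zero] at h1
    exact (mul_eq_zero.1 h1).resolve_right (Nat.cast_add_one_ne_zero _)

theorem totalDegree_pderiv_le {K ι : Type*} [Field K] {F : MvPolynomial ι K} {n : ℕ}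
    (h : F.totalDegree ≤ n + 1) (i : ι) : (pderiv i F).totalDegree ≤ n := by
  classical
  rw [totalDegree, Finset.sup_le_iff] at h ⊢
  intro m hm
  have hm' : m + Finsupp.single i 1 ∈ F.support := by
    rw [MvPolynomial.mem_support_iff, coeff_pderiv] at hm
    exact MvPolynomial.mem_support_iff.2 (left_ne_zero_of_mul hm)
  have := h _ hm'
  rw [Finsupp.sum_add_index' (by simp) (by simp), Finsupp.sum_single_index rfl] at this
  omega

variable {K τ ι : Type} [Field K] [Fintype τ]

/-- The differential at `b` of the polynomial map `P`. -/
def jacobian (P : ι → MvPolynomial τ K) (b : τ → K) : (τ → K) →ₗ[K] (ι → K) :=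
  LinearMap.pi fun i => ∑ j, eval b (pderiv j (P i)) • LinearMap.proj j

theorem jacobian_apply (P : ι → MvPolynomial τ K) (b v : τ → K) (i : ι) :
    jacobian P b v i = ∑ j, eval b (pderiv j (P i)) * v j := by
  simp [jacobian]

theorem jacobian_eq_derivative (P : ι → MvPolynomial τ K) (b v : τ → K) (i : ι) :
    jacobian P b v i = (Polynomial.derivative (aeval (fun j =>
      Polynomial.C (b j) + Polynomial.C (v j) * Polynomial.X) (P i))).eval 0 := by
  rw [jacobian_apply]
  have := derivation_aeval (R := K) Polynomial.derivative' (fun j =>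
      Polynomial.C (b j) + Polynomial.C (v j) * Polynomial.X) (P i)
  rw [Polynomial.derivative'_apply] at this
  rw [this, Polynomial.eval_finsetSum]
  refine Finset.sum_congr rfl fun j _ => ?_
  rw [Polynomial.eval_mul]
  congr 1
  · rw [← Polynomial.coe_evalRingHom, ← RingHom.coe_coe (aeval _), ← RingHom.comp_apply]
    refine congrArg (fun f : MvPolynomial τ K →+* K => f _) ?_
    ext <;> simp
  · simp

variable [Fintype ι] [CharZero K]

theorem algebraicIndependent_of_injective {P : ι → MvPolynomial τ K} {b₀ : τ → K}
    (h : ∀ w : ι → K, (∀ j, ∑ i, w i * eval b₀ (pderiv j (P i)) = 0) → w = 0) :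
    AlgebraicIndependent K P := by
  let ψ : (τ → K) → (ι → K) →ₗ[K] (τ → K) := fun b =>
    LinearMap.pi fun j => ∑ i, eval b (pderiv j (P i)) • LinearMap.proj i
  have hψ : ∀ b w j, ψ b w j = ∑ i, w i * eval b (pderiv j (P i)) := by
    simp [ψ, mul_comm]
  have hinj : Function.Injective (ψ b₀) := by
    rw [← LinearMap.ker_eq_bot, LinearMap.ker_eq_bot']
    intro w hw
    refine h w fun j => ?_
    rw [← hψ, hw]
    rfl
  have hgen := eventually_injective (φ := ψ) (fun w j => by
    simp only [hψ]
    exact IsPoly.sum fun i => IsPoly.mul (IsPoly.const _) ⟨_, fun _ => rfl⟩) hinj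
  rw [AlgebraicIndependent, injective_iff_map_eq_zero]
  have key : ∀ F : MvPolynomial ι K, aeval P F = 0 → ∀ i, aeval P (pderiv i F) = 0 := by
    intro F hF i
    refine MvPolynomial.funext fun b => ?_
    rw [map_zero]
    refine IsPoly.eq_zero (f := fun b => eval b (aeval P (pderiv i F))) ⟨_, fun _ => rfl⟩ ?_ b
    filter_upwards [hgen] with b hb
    have : ψ b (fun i => eval b (aeval P (pderiv i F))) = 0 := by
      ext j
      rw [hψ, Pi.zero_apply]
      have := derivation_aeval (pderiv j) P F
      rw [hF, map_zero] at this
      simpa using (congrArg (eval b) this).symm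
    exact congrFun (hb (this.trans (map_zero _).symm)) i
  suffices ∀ (n : ℕ) (F : MvPolynomial ι K), F.totalDegree ≤ n → aeval P F = 0 → F = 0 from
    fun F => this _ F le_rfl
  intro n
  induction n with
  | zero =>
    intro F hF h0
    rw [totalDegree_eq_zero_iff_eq_C.1 (Nat.le_zero.1 hF)] at h0 ⊢
    rw [aeval_C, algebraMap_eq, C_eq_zero] at h0
    rw [h0, C_0]
  | succ n ih =>
    intro F hF h0
    have := eq_C_of_pderiv_eq_zero fun i => ih _ (totalDegree_pderiv_le hF i) (key F h0 i)
    rw [this, aeval_C, algebraMap_eq, C_eq_zero] at h0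
    rw [this, h0, C_0]

theorem exists_algebraicIndependent (P : ι → MvPolynomial τ K) (b : τ → K) :
    ∃ e : Fin (finrank K (LinearMap.range (jacobian P b))) → ι,
      AlgebraicIndependent K (P ∘ e) := by
  classical
  let M : Matrix ι τ K := Matrix.of fun i j => eval b (pderiv j (P i))
  have hM : jacobian P b = M.mulVecLin := by
    refine LinearMap.ext fun v => funext fun i => ?_
    rw [jacobian_apply]
    rfl
  have hr : finrank K (LinearMap.range (jacobian P b)) =
      finrank K (Submodule.span K (Set.range M.row)) := by
    rw [hM, ← Matrix.rank_eq_finrank_span_row]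
    rfl
  rw [hr]
  obtain ⟨f, hf, -, hli⟩ := Submodule.exists_fun_fin_finrank_span_eq K (Set.range M.row)
  choose e he using fun i => hf i
  refine ⟨e, algebraicIndependent_of_injective (b₀ := b) fun w hw => ?_⟩
  rw [Fintype.linearIndependent_iff] at hli
  refine funext (hli w (funext fun j => ?_))
  rw [Pi.zero_apply, ← hw j]
  simp only [Finset.sum_apply, ← he]
  rfl

end Jacobian

end SegreVeronese

namespace SegreVeronese

open Filter Module

/-! ### Dimension of parametrized varieties -/

section Dimension

theorem ringKrullDim_eq_of_isIntegral {R S : Type} [CommRing R] [CommRing S] [IsDomain S]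
    (g : R →+* S) (hg : Function.Injective g) (hi : g.IsIntegral) :
    ringKrullDim S = ringKrullDim R := by
  algebraize [g]
  have hintegral : Algebra.IsIntegral R S := ⟨hi⟩
  refine le_antisymm ?_ ?_
  · refine Order.krullDim_le_of_strictMono (PrimeSpectrum.comap (algebraMap R S)) fun p q hpq => ?_
    exact Ideal.IsIntegral.comap_lt_comap (R := R) (I := p.asIdeal) (J := q.asIdeal) hpq
  · refine iSup_le fun l => ?_
    obtain ⟨P, hP, hPl⟩ := Ideal.exists_ideal_over_prime_of_isIntegral_of_isDomain (S := S)
      l.head.asIdeal (by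
        rw [(RingHom.injective_iff_ker_eq_bot (algebraMap R S)).1 hg]
        exact bot_le)
    have : P.LiesOver l.head.asIdeal := ⟨hPl.symm⟩
    have : Algebra.HasGoingUp R S := inferInstance
    obtain ⟨L, hL, -⟩ := Ideal.exists_ltSeries_of_hasGoingUp l P
    rw [← hL]
    exact le_iSup (fun L : LTSeries (PrimeSpectrum S) => (L.length : WithBot ℕ∞)) L

variable {K : Type} [Field K]

theorem exists_ringKrullDim_eq_trdeg (A : Type) [CommRing A] [IsDomain A] [Algebra K A]
    [Algebra.FiniteType K A] :
    ∃ k : ℕ, ringKrullDim A = (k : WithBot ℕ∞) ∧ Algebra.trdeg K A = (k : Cardinal) := by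
  obtain ⟨k, g, hg, hi⟩ := exists_integral_inj_algHom_of_fg K A
  refine ⟨k, ?_, ?_⟩
  · rw [ringKrullDim_eq_of_isIntegral (g : MvPolynomial (Fin k) K →+* A) hg hi,
      MvPolynomial.ringKrullDim_of_isNoetherianRing, ringKrullDim_eq_zero_of_field, zero_add,
      Nat.card_fin]
  · algebraize [(g : MvPolynomial (Fin k) K →+* A)]
    have : IsScalarTower K (MvPolynomial (Fin k) K) A := IsScalarTower.of_algebraMap_eq fun x => by
      exact (g.commutes x).symm
    have : FaithfulSMul (MvPolynomial (Fin k) K) A :=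
      (faithfulSMul_iff_algebraMap_injective _ _).2 hg
    have hintegral : Algebra.IsIntegral (MvPolynomial (Fin k) K) A := ⟨hi⟩
    rw [← trdeg_add_eq K (MvPolynomial (Fin k) K) (A := A), trdeg_eq_zero (R := MvPolynomial (Fin k) K), add_zero,
      MvPolynomial.trdeg_of_isDomain]
    simp

variable {τ ι : Type}

theorem vIdeal_range [Infinite K] (P : ι → MvPolynomial τ K) :
    vIdeal K (Set.range fun (b : τ → K) i => eval b (P i)) =
      RingHom.ker (aeval P : MvPolynomial ι K →ₐ[K] MvPolynomial τ K) := by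
  ext F
  have h : ∀ b : τ → K, eval b (aeval P F) = eval (fun i => eval b (P i)) F := fun b => by
    rw [← coe_aeval_eq_eval, ← coe_aeval_eq_eval, RingHom.coe_coe, RingHom.coe_coe, comp_aeval_apply]
  simp only [vIdeal, Submodule.mem_iInf, Set.forall_mem_range, RingHom.mem_ker, ← h]
  exact ⟨fun H => MvPolynomial.funext fun b => by rw [H b, map_zero], fun H b => by
    rw [H, map_zero]⟩

instance (P : ι → MvPolynomial τ K) :
    (RingHom.ker (aeval P : MvPolynomial ι K →ₐ[K] MvPolynomial τ K)).IsPrime :=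
  RingHom.ker_isPrime _

variable [Fintype τ] [Fintype ι]

theorem ringKrullDim_quotient_ker_le (P : ι → MvPolynomial τ K) :
    ringKrullDim (MvPolynomial ι K ⧸
      RingHom.ker (aeval P : MvPolynomial ι K →ₐ[K] MvPolynomial τ K)) ≤
        ((Fintype.card τ : ℕ) : WithBot ℕ∞) := by
  obtain ⟨k, hk, hk'⟩ := exists_ringKrullDim_eq_trdeg (K := K) (MvPolynomial ι K ⧸
      RingHom.ker (aeval P : MvPolynomial ι K →ₐ[K] MvPolynomial τ K))
  have := trdeg_le_of_injective (Ideal.kerLiftAlg (aeval P : MvPolynomial ι K →ₐ[K] MvPolynomial τ K))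
    (Ideal.kerLiftAlg_injective _)
  rw [hk', MvPolynomial.trdeg_of_isDomain] at this
  rw [hk]
  have : k ≤ Fintype.card τ := by simpa using this
  exact_mod_cast this

theorem le_ringKrullDim_quotient_ker [CharZero K] (P : ι → MvPolynomial τ K) (b : τ → K) :
    ((finrank K (LinearMap.range (jacobian P b)) : ℕ) : WithBot ℕ∞) ≤
      ringKrullDim (MvPolynomial ι K ⧸
        RingHom.ker (aeval P : MvPolynomial ι K →ₐ[K] MvPolynomial τ K)) := by
  obtain ⟨k, hk, hk'⟩ := exists_ringKrullDim_eq_trdeg (K := K) (MvPolynomial ι K ⧸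
      RingHom.ker (aeval P : MvPolynomial ι K →ₐ[K] MvPolynomial τ K))
  obtain ⟨e, he⟩ := exists_algebraicIndependent P b
  have he' : AlgebraicIndependent K fun i => (Ideal.Quotient.mkₐ K (RingHom.ker
      (aeval P : MvPolynomial ι K →ₐ[K] MvPolynomial τ K))) (X (e i)) := by
    refine AlgebraicIndependent.of_comp
      (Ideal.kerLiftAlg (aeval P : MvPolynomial ι K →ₐ[K] MvPolynomial τ K)) ?_
    convert! he using 1
    ext1 i
    exact aeval_X P (e i)
  have := he'.cardinalMk_le_trdeg
  rw [hk'] at this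
  rw [hk]
  have : finrank K (LinearMap.range (jacobian P b)) ≤ k := by
    rwa [Cardinal.mk_fin, Nat.cast_le] at this
  exact_mod_cast this

end Dimension

end SegreVeronese

namespace SegreVeronese

open Filter Module

/-! ### Specialization of the first factor to coordinate points -/

section Specialization

variable {K : Type} [Field K] {σ γ : Type} [Fintype σ] {d h : ℕ}

/-- The differential at `b` of the Veronese map, in monomial coordinates. -/
def tanMon (d : ℕ) (b : σ → K) : (σ → K) →ₗ[K] (Mon σ d → K) :=
  LinearMap.funLeft K K indices ∘ₗ tan d b

theorem tanMon_apply (b v : σ → K) (μ : Mon σ d) : tanMon d b v μ = tan d b v (indices μ) := rfl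

theorem tanMon_self (b : σ → K) : tanMon d b b = (d : K) • monomials d b := by
  ext μ
  rw [tanMon_apply, tan_self, Pi.smul_apply, rankOne_indices, Pi.smul_apply]

theorem Independent.exists_injective {ι : Type} [Fintype ι] (H : Independent K σ d ι) :
    ∃ z : ι → σ → K, Function.Injective
      (∑ i, tanMon d (z i) ∘ₗ LinearMap.proj i : (ι → σ → K) →ₗ[K] (Mon σ d → K)) := by
  obtain ⟨z, hz⟩ := H
  refine ⟨z, ?_⟩
  rw [← LinearMap.ker_eq_bot, LinearMap.ker_eq_bot']
  intro v hv
  refine hz v (funext fun t => ?_)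
  obtain ⟨μ, hμ⟩ := exists_tan_apply_eq (K := K) t
  have := congrFun hv μ
  simpa [tanMon_apply, hμ] using this

/-- The differential at `(a, b)` of the parametrization of the Segre–Veronese cone. -/
def svTan (d : ℕ) (a : γ → K) (b : σ → K) :
    ((γ → K) × (σ → K)) →ₗ[K] (γ × Mon σ d → K) :=
  (LinearMap.pi fun p => monomials d b p.2 • LinearMap.proj p.1).coprod
    (LinearMap.pi fun p => a p.1 • (LinearMap.proj p.2 ∘ₗ tanMon d b))

theorem svTan_apply (a a' : γ → K) (b v : σ → K) (p : γ × Mon σ d) :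
    svTan d a b (a', v) p = monomials d b p.2 * a' p.1 + a p.1 * tanMon d b v p.2 := by
  simp [svTan]

variable [Fintype γ]

/-- Tangent vectors at the points `b (c, l)` and multiples of all the points. -/
def doubleSimple (d : ℕ) (c : γ) (b : (γ × Fin h) × σ → K) :
    ((Fin h → σ → K) × (γ × Fin h → K)) →ₗ[K] (Mon σ d → K) :=
  (∑ l, tanMon d (fun j => b ((c, l), j)) ∘ₗ LinearMap.proj l).coprod
    (∑ p, (LinearMap.proj p).smulRight (monomials d fun j => b (p, j)))

theorem doubleSimple_apply (c : γ) (b : (γ × Fin h) × σ → K) (v : Fin h → σ → K)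
    (w : γ × Fin h → K) : doubleSimple d c b (v, w) =
      ∑ l, tanMon d (fun j => b ((c, l), j)) (v l) + ∑ p, w p • monomials d fun j => b (p, j) := by
  simp [doubleSimple]

theorem exists_doubleSimple_surjective [Infinite K] (H : Independent K σ d (Fin h))
    (hc : Fintype.card (Mon σ d) + h ≤ h * (Fintype.card σ + Fintype.card γ)) (c : γ) :
    ∃ b : (γ × Fin h) × σ → K, LinearMap.range (doubleSimple d c b) = ⊤ := by
  classical
  obtain ⟨z, hz⟩ := H.exists_injective
  set U := LinearMap.range
    (∑ i, tanMon d (z i) ∘ₗ LinearMap.proj i : (Fin h → σ → K) →ₗ[K] (Mon σ d → K)) with hU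
  have hUr : finrank K U = h * Fintype.card σ := by
    rw [hU, LinearMap.finrank_range_of_inj hz, finrank_pi_fintype]
    simp
  have hQ : finrank K ((Mon σ d → K) ⧸ U) ≤ Fintype.card ({c' // c' ≠ c} × Fin h) := by
    have := U.finrank_quotient_add_finrank
    rw [hUr, finrank_fintype_fun_eq_card] at this
    have h1 : Fintype.card {c' // c' ≠ c} + 1 = Fintype.card γ := by
      have := Fintype.card_pos_iff.2 ⟨c⟩
      rw [Fintype.card_subtype_compl, Fintype.card_subtype_eq]
      omega
    rw [Fintype.card_prod, Fintype.card_fin]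
    rw [← h1] at hc
    nlinarith
  obtain ⟨f, hf, hspan, -⟩ := Submodule.exists_fun_fin_finrank_span_eq K
    (Set.range fun x : σ → K => U.mkQ (monomials d x))
  have htop : Submodule.span K (Set.range fun x : σ → K => U.mkQ (monomials d x)) = ⊤ := by
    rw [show (fun x : σ → K => U.mkQ (monomials d x)) = U.mkQ ∘ monomials d from rfl,
      Set.range_comp, ← Submodule.map_span, span_monomials, Submodule.map_top, Submodule.range_mkQ]
  have hspan := hspan.trans htop
  choose x hx using hf
  obtain ⟨e⟩ := Function.Embedding.nonempty_of_card_le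
    (α := Fin (finrank K (Submodule.span K (Set.range fun x : σ → K => U.mkQ (monomials d x)))))
    (β := {c' // c' ≠ c} × Fin h) (by
      rw [Fintype.card_fin, htop, finrank_top]
      exact hQ)
  refine ⟨fun p => if hp : p.1.1 = c then z p.1.2 p.2 else
    Function.extend e x 0 (⟨p.1.1, hp⟩, p.1.2) p.2, ?_⟩
  set b : (γ × Fin h) × σ → K := fun p => if hp : p.1.1 = c then z p.1.2 p.2 else
    Function.extend e x 0 (⟨p.1.1, hp⟩, p.1.2) p.2 with hb
  have hUle : U ≤ LinearMap.range (doubleSimple d c b) := by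
    rintro _ ⟨v, rfl⟩
    refine ⟨(v, 0), ?_⟩
    simp [doubleSimple_apply, hb]
  have hxle : ∀ k, monomials d (x k) ∈ LinearMap.range (doubleSimple d c b) := by
    intro k
    refine ⟨(0, Pi.single ((e k).1.1, (e k).2) 1), ?_⟩
    rw [doubleSimple_apply, Finset.sum_eq_single ((e k).1.1, (e k).2)]
    · have hbx : (fun j => b (((e k).1.1, (e k).2), j)) = x k := by
        ext j
        rw [hb]
        dsimp only
        rw [dif_neg (e k).1.2]
        exact congrFun (e.injective.extend_apply x 0 k) j
      rw [hbx, Pi.single_eq_same, one_smul]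
      simp
    · intro p _ hp
      rw [Pi.single_eq_of_ne hp, zero_smul]
    · simp
  have : Submodule.map U.mkQ (LinearMap.range (doubleSimple d c b)) = ⊤ := by
    rw [eq_top_iff, ← hspan, Submodule.span_le]
    rintro _ ⟨k, rfl⟩
    exact ⟨_, hxle k, hx k⟩
  have h2 := Submodule.comap_map_mkQ U (LinearMap.range (doubleSimple d c b))
  rw [this, Submodule.comap_top, sup_eq_right.2 hUle] at h2
  exact h2.symm

theorem eventually_doubleSimple_surjective [Infinite K] (H : Independent K σ d (Fin h))
    (hc : Fintype.card (Mon σ d) + h ≤ h * (Fintype.card σ + Fintype.card γ)) :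
    ∀ᶠ b in gen K ((γ × Fin h) × σ), ∀ c : γ, LinearMap.range (doubleSimple d c b) = ⊤ := by
  rw [eventually_all]
  intro c
  obtain ⟨b₀, hb₀⟩ := exists_doubleSimple_surjective H hc c
  filter_upwards [eventually_finrank_range_ge (φ := fun b => doubleSimple d c b) (by
    rintro ⟨v, w⟩ μ
    simp only [doubleSimple_apply, Pi.add_apply, Finset.sum_apply, Pi.smul_apply, smul_eq_mul,
      tanMon_apply, monomials]
    refine IsPoly.add (IsPoly.sum fun l => ?_) (IsPoly.sum fun p => ?_)
    · exact isPoly_tan (b := fun z j => z ((c, l), j)) (v := fun _ => v l)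
        (fun j => IsPoly.coord _) (fun j => IsPoly.const _) _
    · exact IsPoly.mul (IsPoly.const _) (IsPoly.prod fun i => IsPoly.pow (IsPoly.coord _) _)) b₀]
    with b hb
  refine Submodule.eq_top_of_finrank_eq (le_antisymm (Submodule.finrank_le _) ?_)
  rwa [hb₀, finrank_top] at hb

theorem finrank_range_svTan_lt [Nonempty γ] (hd : d ≠ 0) (a : γ → K) (b : σ → K) :
    finrank K (LinearMap.range (svTan d a b)) + 1 ≤ Fintype.card γ + Fintype.card σ := by
  have h1 := (svTan d a b).finrank_range_add_finrank_ker
  rw [finrank_prod, finrank_fintype_fun_eq_card, finrank_fintype_fun_eq_card] at h1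
  rw [← h1]
  refine Nat.add_le_add_left (Nat.one_le_iff_ne_zero.2 fun h0 => ?_) _
  rw [Submodule.finrank_eq_zero, LinearMap.ker_eq_bot'] at h0
  have hb : b = 0 := by
    have h2 := h0 ((d : K) • a, -b) (by
      ext p
      rw [svTan_apply, map_neg, tanMon_self]
      simp
      ring)
    simpa using congrArg Prod.snd h2
  have h3 := h0 (1, 0) (by
    ext p
    obtain ⟨i, -, hi⟩ : ∃ i ∈ Finset.univ, p.2.1 i ≠ 0 := by
      refine Finset.exists_ne_zero_of_sum_ne_zero ?_
      rwa [p.2.2]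
    have : monomials d (0 : σ → K) p.2 = 0 :=
      Finset.prod_eq_zero (Finset.mem_univ i) (by simp [hi])
    simp [svTan_apply, hb, this])
  exact one_ne_zero (congrArg Prod.fst h3)

theorem exists_iSup_svTan_eq_top [CharZero K] (H : Independent K σ d (Fin h))
    (hc : Fintype.card (Mon σ d) + h ≤ h * (Fintype.card σ + Fintype.card γ)) :
    ∃ (a : γ × Fin h → γ → K) (b : γ × Fin h → σ → K),
      ⨆ p, LinearMap.range (svTan d (a p) (b p)) = ⊤ := by
  classical
  obtain ⟨b, hb⟩ := (eventually_doubleSimple_surjective (γ := γ) H hc).exists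
  refine ⟨fun p => Pi.single p.1 1, fun p j => b (p, j), ?_⟩
  set S := ⨆ p : γ × Fin h, LinearMap.range
    (svTan d (Pi.single p.1 1 : γ → K) (fun j => b (p, j))) with hS
  let E : γ → (Mon σ d → K) →ₗ[K] (γ × Mon σ d → K) := fun c =>
    LinearMap.pi fun p => (Pi.single c 1 : γ → K) p.1 • LinearMap.proj p.2
  have hE : ∀ c w p, E c w p = (Pi.single c 1 : γ → K) p.1 * w p.2 := fun c w p => by simp [E]
  have hmon : ∀ c p, E c (monomials d fun j => b (p, j)) ∈ S := by
    intro c p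
    refine Submodule.mem_iSup_of_mem p ⟨(Pi.single c 1, 0), ?_⟩
    ext q
    rw [svTan_apply, hE, map_zero]
    simp [mul_comm]
  have htan : ∀ c l v, E c (tanMon d (fun j => b ((c, l), j)) v) ∈ S := by
    intro c l v
    refine Submodule.mem_iSup_of_mem (c, l) ⟨(0, v), ?_⟩
    ext q
    rw [svTan_apply, hE]
    simp
  have hall : ∀ c w, E c w ∈ S := by
    intro c w
    obtain ⟨⟨v, u⟩, rfl⟩ := LinearMap.range_eq_top.1 (hb c) w
    rw [doubleSimple_apply]
    simp only [map_add, map_sum, map_smul]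
    exact S.add_mem (S.sum_mem fun l _ => htan c l _) (S.sum_mem fun p _ => S.smul_mem _ (hmon c p))
  rw [eq_top_iff]
  intro y _
  have : y = ∑ c, E c fun μ => y (c, μ) := by
    ext p
    simp [hE, Pi.single_apply]
  rw [this]
  exact S.sum_mem fun c _ => hall c _

end Specialization

/-! ### Expected dimension of joins from the perfect case -/

theorem min_le_finrank_iSup {K V : Type*} [Field K] [AddCommGroup V] [Module K V]
    [FiniteDimensional K V] {f : ℕ → Submodule K V} {r S : ℕ} (hf : ∀ i, finrank K (f i) ≤ r)
    (htop : ⨆ i ∈ Finset.range S, f i = ⊤) (hr : finrank K V = S * r) (s : ℕ) :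
    min (finrank K V) (s * r) ≤ finrank K (⨆ i ∈ Finset.range s, f i : Submodule K V) := by
  rcases le_total S s with h | h
  · have : ⨆ i ∈ Finset.range s, f i = ⊤ := by
      rw [eq_top_iff, ← htop]
      exact biSup_mono fun i hi => Finset.range_mono h hi
    rw [this, finrank_top]
    exact min_le_left _ _
  · have key : ∀ k, finrank K (⨆ i ∈ Finset.range (s + k), f i : Submodule K V) ≤
        finrank K (⨆ i ∈ Finset.range s, f i : Submodule K V) + k * r := by
      intro k
      induction k with
      | zero => simp
      | succ k ih =>
        rw [← Nat.add_assoc, Finset.range_add_one, Finset.iSup_insert]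
        have := Submodule.finrank_add_le_finrank_add_finrank (f (s + k))
          (⨆ i ∈ Finset.range (s + k), f i)
        have := hf (s + k)
        rw [Nat.succ_mul]
        omega
    obtain ⟨k, rfl⟩ := Nat.exists_eq_add_of_le h
    have := key k
    rw [htop, finrank_top, hr, Nat.add_mul] at this
    exact (min_le_right _ _).trans (by omega)

end SegreVeronese

namespace SegreVeronese

open Filter Module

/-! ### Secant varieties of Segre–Veronese varieties -/

section Secant

variable {K : Type} [Field K] {σ γ : Type} [Fintype σ] {d s : ℕ}

/-- The coordinates of a general point on a secant variety of the Segre–Veronese variety. -/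
def svPoly (K : Type) [Field K] (γ : Type) (d s : ℕ) (p : γ × Mon σ d) :
    MvPolynomial (Fin s × (γ ⊕ σ)) K :=
  ∑ i, X (i, Sum.inl p.1) * ∏ j, X (i, Sum.inr j) ^ p.2.1 j

theorem eval_svPoly (b : Fin s × (γ ⊕ σ) → K) (p : γ × Mon σ d) :
    eval b (svPoly K γ d s p) = ∑ i, b (i, Sum.inl p.1) * ∏ j, b (i, Sum.inr j) ^ p.2.1 j := by
  simp [svPoly]

theorem secantCone_svCone (n m d s : ℕ) : secantCone K (svCone K n m d) s =
    Set.range fun (b : Fin s × (Fin (n + 1) ⊕ Fin (m + 1)) → K) p =>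
      eval b (svPoly K (Fin (n + 1)) d s p) := by
  ext y
  constructor
  · rintro ⟨x, hx, rfl⟩
    choose a b hab using hx
    refine ⟨fun q => Sum.elim (a q.1) (b q.1) q.2, ?_⟩
    ext p
    simp [eval_svPoly, hab]
  · rintro ⟨b, rfl⟩
    refine ⟨fun i p => b (i, Sum.inl p.1) * ∏ j, b (i, Sum.inr j) ^ p.2.1 j,
      fun i => ⟨fun c => b (i, Sum.inl c), fun j => b (i, Sum.inr j), rfl⟩, ?_⟩
    ext p
    simp [eval_svPoly]

theorem jacobian_svPoly [Fintype γ] (b v : Fin s × (γ ⊕ σ) → K) :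
    jacobian (svPoly K γ d s) b v = ∑ i, svTan d (fun c => b (i, Sum.inl c))
      (fun j => b (i, Sum.inr j)) (fun c => v (i, Sum.inl c), fun j => v (i, Sum.inr j)) := by
  ext p
  rw [jacobian_eq_derivative, svPoly, map_sum, Polynomial.derivative_sum,
    Polynomial.eval_finsetSum, Finset.sum_apply]
  refine Finset.sum_congr rfl fun i _ => ?_
  rw [svTan_apply, tanMon_apply, tan_apply_eq_derivative,
    prod_indices p.2 fun j => Polynomial.C (b (i, Sum.inr j)) +
      Polynomial.C (v (i, Sum.inr j)) * Polynomial.X]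
  simp [monomials, Polynomial.eval_prod]
  ring

theorem iSup_range_svTan_le [Fintype γ] (b : Fin s × (γ ⊕ σ) → K) :
    ⨆ i, LinearMap.range (svTan d (fun c => b (i, Sum.inl c)) (fun j => b (i, Sum.inr j))) ≤
      LinearMap.range (jacobian (svPoly K γ d s) b) := by
  classical
  refine iSup_le fun i => ?_
  rintro _ ⟨⟨a, v⟩, rfl⟩
  refine ⟨fun q => if q.1 = i then Sum.elim a v q.2 else 0, ?_⟩
  rw [jacobian_svPoly, Finset.sum_eq_single i]
  · simp
  · intro k _ hk
    simp only [hk, if_false]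
    exact map_zero _
  · simp

theorem min_le_ringKrullDim_svPoly [CharZero K] [Fintype γ] [Nonempty γ] {h : ℕ} (hd : d ≠ 0)
    (H : Independent K σ d (Fin h))
    (hc : Fintype.card (Mon σ d) + h = h * (Fintype.card σ + Fintype.card γ)) (s : ℕ) :
    ((min (Fintype.card γ * Fintype.card (Mon σ d))
        (s * (Fintype.card γ + Fintype.card σ - 1)) : ℕ) : WithBot ℕ∞) ≤
      ringKrullDim (MvPolynomial (γ × Mon σ d) K ⧸ RingHom.ker
        (aeval (svPoly K γ d s) : MvPolynomial (γ × Mon σ d) K →ₐ[K] _)) := by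
  obtain ⟨a, b, hab⟩ := exists_iSup_svTan_eq_top H hc.le
  let e : Fin (Fintype.card (γ × Fin h)) ≃ γ × Fin h := (Fintype.equivFin _).symm
  let A : ℕ → γ → K := fun i => if hi : i < Fintype.card (γ × Fin h) then a (e ⟨i, hi⟩) else 0
  let B : ℕ → σ → K := fun i => if hi : i < Fintype.card (γ × Fin h) then b (e ⟨i, hi⟩) else 0
  have htop : ⨆ i ∈ Finset.range (Fintype.card (γ × Fin h)),
      LinearMap.range (svTan d (A i) (B i)) = ⊤ := by
    rw [eq_top_iff, ← hab]
    refine iSup_le fun p => ?_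
    obtain ⟨i, rfl⟩ := e.surjective p
    refine le_trans (le_of_eq ?_) (le_iSup₂_of_le (i : ℕ) (Finset.mem_range.2 i.2) le_rfl)
    simp only [A, B, i.2, dif_pos, Fin.eta]
  have hγ := Fintype.card_pos (α := γ)
  have hr : finrank K (γ × Mon σ d → K) =
      Fintype.card (γ × Fin h) * (Fintype.card γ + Fintype.card σ - 1) := by
    rw [finrank_fintype_fun_eq_card, Fintype.card_prod, Fintype.card_prod, Fintype.card_fin,
      mul_assoc]
    congr 1
    obtain ⟨t, ht⟩ : ∃ t, Fintype.card γ + Fintype.card σ = t + 1 :=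
      ⟨Fintype.card γ + Fintype.card σ - 1, by omega⟩
    rw [add_comm (Fintype.card σ), ht] at hc
    rw [ht, Nat.add_sub_cancel]
    linarith
  have key := min_le_finrank_iSup (fun i => by
    have := finrank_range_svTan_lt hd (A i) (B i)
    omega) htop hr s
  rw [finrank_fintype_fun_eq_card, Fintype.card_prod] at key
  refine le_trans ?_ (le_ringKrullDim_quotient_ker (svPoly K γ d s)
    fun q => Sum.elim (A q.1) (B q.1) q.2)
  refine Nat.cast_le.2 (key.trans (Submodule.finrank_mono (le_trans ?_ (iSup_range_svTan_le _))))
  refine iSup₂_le fun i hi => ?_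
  exact le_iSup_of_le (⟨i, Finset.mem_range.1 hi⟩ : Fin s) le_rfl

/-- The general point on a secant variety, in terms of points of the affine chart on which the
first coordinate of the second factor is one. -/
def svPolyChart (K : Type) [Field K] (γ : Type) (m d s : ℕ) (p : γ × Mon (Fin (m + 1)) d) :
    MvPolynomial (Fin s × (γ ⊕ Fin m)) K :=
  ∑ i, X (i, Sum.inl p.1) * ∏ j, X (i, Sum.inr j) ^ p.2.1 (Fin.succ j)

theorem ker_svPolyChart_le [Infinite K] (m : ℕ) :
    RingHom.ker (aeval (svPolyChart K γ m d s) : MvPolynomial _ K →ₐ[K] _) ≤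
      RingHom.ker (aeval (svPoly K γ d s) : MvPolynomial (γ × Mon (Fin (m + 1)) d) K →ₐ[K] _) := by
  intro F hF
  rw [RingHom.mem_ker] at hF ⊢
  refine MvPolynomial.funext fun b => ?_
  rw [map_zero]
  refine IsPoly.eq_zero (f := fun b => eval b (aeval (svPoly K γ d s) F)) ⟨_, fun _ => rfl⟩ ?_ b
  have hne : ∀ᶠ b in gen K (Fin s × (γ ⊕ Fin (m + 1))), ∀ i, b (i, Sum.inr 0) ≠ 0 :=
    eventually_all.2 fun i => (IsPoly.coord _).eventually_ne ⟨1, one_ne_zero⟩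
  filter_upwards [hne] with b hb
  have hcomp : ∀ {τ : Type} (P : γ × Mon (Fin (m + 1)) d → MvPolynomial τ K) (z : τ → K),
      eval z (aeval P F) = eval (fun p => eval z (P p)) F := by
    intro τ P z
    have := DFunLike.congr_fun (comp_aeval P (aeval z : MvPolynomial τ K →ₐ[K] K)) F
    simpa [coe_aeval_eq_eval] using this
  rw [hcomp]
  have h0 := congrArg (eval fun q : Fin s × (γ ⊕ Fin m) => Sum.elim
    (fun c => b (q.1, Sum.inl c) * b (q.1, Sum.inr 0) ^ d)
    (fun j => b (q.1, Sum.inr (Fin.succ j)) / b (q.1, Sum.inr 0)) q.2) hF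
  rw [hcomp, map_zero] at h0
  rw [← h0]
  congr 2
  ext p
  rw [eval_svPoly, svPolyChart, map_sum]
  refine Finset.sum_congr rfl fun i _ => ?_
  obtain ⟨c, μ, hμ⟩ := p
  rw [Fin.sum_univ_succ] at hμ
  simp only [map_mul, map_prod, map_pow, eval_X, Sum.elim_inl, Sum.elim_inr]
  rw [Fin.prod_univ_succ, ← hμ, pow_add, ← Finset.prod_pow_eq_pow_sum, mul_assoc, mul_assoc,
    ← Finset.prod_mul_distrib]
  congr 2
  refine Finset.prod_congr rfl fun j _ => ?_
  rw [← mul_pow, mul_div_cancel₀ _ (hb i)]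

theorem ringKrullDim_svPoly_le [Infinite K] [Fintype γ] (m : ℕ) :
    ringKrullDim (MvPolynomial (γ × Mon (Fin (m + 1)) d) K ⧸ RingHom.ker
      (aeval (svPoly K γ d s) : MvPolynomial (γ × Mon (Fin (m + 1)) d) K →ₐ[K] _)) ≤
    ((min (Fintype.card γ * Fintype.card (Mon (Fin (m + 1)) d)) (s * (Fintype.card γ + m)) : ℕ) :
      WithBot ℕ∞) := by
  have h1 : ringKrullDim (MvPolynomial (γ × Mon (Fin (m + 1)) d) K ⧸ RingHom.ker
      (aeval (svPoly K γ d s) : MvPolynomial (γ × Mon (Fin (m + 1)) d) K →ₐ[K] _)) ≤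
      ((Fintype.card γ * Fintype.card (Mon (Fin (m + 1)) d) : ℕ) : WithBot ℕ∞) := by
    refine (ringKrullDim_quotient_le _).trans ?_
    rw [MvPolynomial.ringKrullDim_of_isNoetherianRing, ringKrullDim_eq_zero_of_field]
    simp
  have h2 : ringKrullDim (MvPolynomial (γ × Mon (Fin (m + 1)) d) K ⧸ RingHom.ker
      (aeval (svPoly K γ d s) : MvPolynomial (γ × Mon (Fin (m + 1)) d) K →ₐ[K] _)) ≤
      ((s * (Fintype.card γ + m) : ℕ) : WithBot ℕ∞) := by
    refine (ringKrullDim_le_of_surjective (Ideal.Quotient.factor (ker_svPolyChart_le m))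
      (Ideal.Quotient.factor_surjective _)).trans ((ringKrullDim_quotient_ker_le _).trans ?_)
    simp
  rcases min_choice (Fintype.card γ * Fintype.card (Mon (Fin (m + 1)) d))
    (s * (Fintype.card γ + m)) with h | h <;> rw [h] <;> assumption

end Secant

end SegreVeronese

/-- **Remark.**  Let `d ≥ 3`, `n, m ≥ 1` and suppose `C(m+d,d) = h(m+n+1)`.  Then
`s₁ = s₂ = h(n+1)` (where `s₁` is the largest multiple of `n+1` at most
`⌊(n+1)·C(m+d,d)/(m+n+1)⌋` and `s₂` the smallest multiple of `n+1` at least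
`⌈(n+1)·C(m+d,d)/(m+n+1)⌉`), and `σ_s(X^{(n,m)}_{(1,d)})` has the expected dimension
`min {N, s(dim X + 1) − 1} = min {N, s(n+m+1) − 1}` for every `s`, where
`N = (n+1)·C(m+d,d) − 1` and `dim X^{(n,m)}_{(1,d)} = n + m`. -/
theorem stmt3 (K : Type) [Field K] [IsAlgClosed K] [CharZero K]
    (n m d h : ℕ) (hd : 3 ≤ d) (hn : 1 ≤ n) (hm : 1 ≤ m)
    (hC : (m + d).choose d = h * (m + n + 1))
    (N : ℕ) (hN : N = (n + 1) * ((m + d).choose d) - 1)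
    (s₁ s₂ : ℕ)
    (hs₁ : (n + 1) ∣ s₁ ∧ s₁ * (m + n + 1) ≤ (n + 1) * ((m + d).choose d) ∧
      ∀ s', (n + 1) ∣ s' → s' * (m + n + 1) ≤ (n + 1) * ((m + d).choose d) → s' ≤ s₁)
    (hs₂ : (n + 1) ∣ s₂ ∧ (n + 1) * ((m + d).choose d) ≤ s₂ * (m + n + 1) ∧
      ∀ s', (n + 1) ∣ s' → (n + 1) * ((m + d).choose d) ≤ s' * (m + n + 1) → s₂ ≤ s') :
    s₁ = h * (n + 1) ∧ s₂ = h * (n + 1) ∧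
    ∀ s : ℕ, 1 ≤ s →
      HasProjDim K (secantCone K (svCone K n m d) s) (min N (s * (n + m + 1) - 1)) := by
  have hpos : 0 < m + n + 1 := Nat.succ_pos _
  have hCN : (n + 1) * ((m + d).choose d) = h * (n + 1) * (m + n + 1) := by rw [hC]; ring
  have hle : s₁ ≤ h * (n + 1) := Nat.le_of_mul_le_mul_right (hCN ▸ hs₁.2.1) hpos
  have hge : h * (n + 1) ≤ s₂ := Nat.le_of_mul_le_mul_right (hCN ▸ hs₂.2.1) hpos
  refine ⟨le_antisymm hle (hs₁.2.2 _ (Dvd.intro_left _ rfl) hCN.ge),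
    le_antisymm (hs₂.2.2 _ (Dvd.intro_left _ rfl) hCN.le) hge, fun s hs => ?_⟩
  have hcard : Fintype.card (SegreVeronese.Mon (Fin (m + 1)) d) = (m + d).choose d := by
    rw [SegreVeronese.card_mon, Fintype.card_fin, Nat.add_right_comm, Nat.add_sub_cancel]
  have H : SegreVeronese.Independent K (Fin (m + 1)) d (Fin h) :=
    SegreVeronese.independent_of_three_le hd hm
      (hC ▸ Nat.mul_le_mul_left h (by omega : m + 2 ≤ m + n + 1))
  have hlow := SegreVeronese.min_le_ringKrullDim_svPoly (γ := Fin (n + 1)) (by omega : d ≠ 0) H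
    (by rw [hcard, hC, Fintype.card_fin, Fintype.card_fin]; ring) s
  have hup := SegreVeronese.ringKrullDim_svPoly_le (K := K) (γ := Fin (n + 1)) (d := d) (s := s) m
  rw [hcard, Fintype.card_fin] at hlow hup
  rw [Fintype.card_fin] at hlow
  have hD : min N (s * (n + m + 1) - 1) + 1 =
      min ((n + 1) * (m + d).choose d) (s * (n + m + 1)) := by
    have h1 : 0 < (n + 1) * (m + d).choose d :=
      Nat.mul_pos n.succ_pos (Nat.choose_pos (Nat.le_add_left d m))
    have h2 : 0 < s * (n + m + 1) := Nat.mul_pos hs (Nat.succ_pos _)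
    omega
  rw [show n + 1 + (m + 1) - 1 = n + m + 1 by omega] at hlow
  rw [show n + 1 + m = n + m + 1 by omega] at hup
  rw [HasProjDim, coneKrullDim, SegreVeronese.secantCone_svCone, SegreVeronese.vIdeal_range,
    le_antisymm hup hlow, ← hD]
  push_cast
  rfl
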